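/- arXiv:math/0208129 — 6 statements merged into one kernel-verified Lean document; each statement's English description precedes it below -/
import Mathlib

section
/- Let a > 0, l ∈ ℕ₀ and 0 < ε < 1. Let f : ℝ → ℂ be continuous with f(x) = O(|x|^{-a}) as |x| → ∞, and assume f is C^l on some neighborhood of 0 with f^{(l)} Hölder continuous of index ε on that neighborhood. Then the map α ↦ x_+^α(f) = (1/Γ(α+1)) ∫₀^∞ f(x) x^α dx, initially defined for -1 < Re α < a - 1, extends uniquely to a holomorphic function F on the strip {α ∈ ℂ : -l - ε - 1 < Re α < a - 1}, and F(α) = (-1)^{-α-1} f^{(-α-1)}(0) for every integer α ∈ {-l-1, -l, …, -1}. -/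
open Complex MeasureTheory Filter Asymptotics Set

/-- `x₊^α(f) = (1/Γ(α+1)) ∫₀^∞ f(x) x^α dx`. -/
noncomputable def xplus (f : ℝ → ℂ) (α : ℂ) : ℂ :=
  (Complex.Gamma (α + 1))⁻¹ * ∫ x in Set.Ioi (0 : ℝ), f x * (x : ℂ) ^ α

/-- Taylor's theorem with a Hölder estimate of the remainder. -/
theorem taylor_isBigO_rpow_of_holder {E : Type*} [NormedAddCommGroup E] [NormedSpace ℝ E]
    {f : ℝ → E} {O : Set ℝ} {x₀ M ε : ℝ} {n : ℕ} (hε : 0 ≤ ε) (hO : IsOpen O) (hx₀ : x₀ ∈ O)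
    (hf : ContDiffOn ℝ n f O)
    (hM : ∀ x ∈ O, ‖iteratedDerivWithin n f O x - iteratedDerivWithin n f O x₀‖
      ≤ M * |x - x₀| ^ ε) :
    (fun x ↦ f x - taylorWithinEval f n O x₀ x) =O[nhds x₀] fun x ↦ |x - x₀| ^ (n + ε) := by
  induction n generalizing f with
  | zero =>
    refine IsBigO.of_bound M ?_
    filter_upwards [hO.mem_nhds hx₀] with x hx
    have h := hM x hx
    simp only [iteratedDerivWithin_zero] at h
    rw [taylor_within_zero_eval, Nat.cast_zero, zero_add, Real.norm_eq_abs,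
      abs_of_nonneg (Real.rpow_nonneg (abs_nonneg _) _)]
    exact h
  | succ n ih =>
    push_cast at hf
    have hd := ih (hf.derivWithin hO.uniqueDiffOn le_rfl) fun x hx ↦ by
      simpa only [iteratedDerivWithin_succ'] using hM x hx
    obtain ⟨C, hC0, hC⟩ := hd.exists_nonneg
    obtain ⟨δ, hδ, hball⟩ := Metric.eventually_nhds_iff_ball.1
      (hC.bound.and (hO.mem_nhds hx₀))
    refine IsBigO.of_bound C ?_
    filter_upwards [Metric.ball_mem_nhds x₀ hδ] with x hx
    have hr : |x - x₀| < δ := by simpa [Real.dist_eq] using hx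
    have hsub : Metric.closedBall x₀ |x - x₀| ⊆ Metric.ball x₀ δ :=
      Metric.closedBall_subset_ball hr
    have key := (convex_closedBall x₀ |x - x₀|).norm_image_sub_le_of_norm_hasDerivWithin_le
      (f := fun x ↦ f x - taylorWithinEval f (n + 1) O x₀ x)
      (f' := fun x ↦ derivWithin f O x - taylorWithinEval (derivWithin f O) n O x₀ x)
      (C := C * |x - x₀| ^ (n + ε)) (x := x₀) (y := x) ?_ ?_
      (Metric.mem_closedBall_self (abs_nonneg _)) (by simp [Real.dist_eq])
    · simp only [taylorWithinEval_self, sub_self, sub_zero] at key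
      refine key.trans_eq ?_
      rw [Real.norm_eq_abs, Real.norm_eq_abs, abs_of_nonneg (Real.rpow_nonneg (abs_nonneg _) _),
        mul_assoc, ← Real.rpow_add_one' (abs_nonneg _) (by positivity)]
      push_cast
      ring_nf
    · intro y hy
      have hyO := (hball y (hsub hy)).2
      exact ((hf.differentiableOn (by simp) y hyO).hasDerivWithinAt.hasDerivAt
        (hO.mem_nhds hyO)).hasDerivWithinAt.sub
        (hasDerivAt_taylorWithinEval_succ f n).hasDerivWithinAt
    · intro y hy
      refine (hball y (hsub hy)).1.trans ?_
      rw [Real.norm_eq_abs, abs_of_nonneg (Real.rpow_nonneg (abs_nonneg _) _)]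
      have : |y - x₀| ≤ |x - x₀| := by simpa [Real.dist_eq] using hy
      gcongr

/-- The entire function `s ↦ 1 / ((s + k) Γ(s))`. -/
noncomputable def oneDivAddMulGamma (k : ℕ) (s : ℂ) : ℂ :=
  (∏ j ∈ Finset.range k, (s + j)) * (Gamma (s + k + 1))⁻¹

theorem one_div_Gamma_eq_prod_mul_one_div_Gamma_add (n : ℕ) (s : ℂ) :
    (Gamma s)⁻¹ = (∏ j ∈ Finset.range n, (s + j)) * (Gamma (s + n))⁻¹ := by
  induction n with
  | zero => simp
  | succ n ih =>
    rw [ih, Finset.prod_range_succ, one_div_Gamma_eq_self_mul_one_div_Gamma_add_one (s + n)]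
    push_cast
    ring_nf

theorem add_mul_oneDivAddMulGamma (k : ℕ) (s : ℂ) :
    (s + k) * oneDivAddMulGamma k s = (Gamma s)⁻¹ := by
  rw [one_div_Gamma_eq_prod_mul_one_div_Gamma_add (k + 1), oneDivAddMulGamma,
    Finset.prod_range_succ]
  push_cast
  ring_nf

theorem differentiable_oneDivAddMulGamma (k : ℕ) : Differentiable ℂ (oneDivAddMulGamma k) := by
  have h : Differentiable ℂ fun s : ℂ ↦ (Gamma (s + k + 1))⁻¹ :=
    differentiable_one_div_Gamma.comp (f := fun s : ℂ ↦ s + k + 1) (by fun_prop)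
  unfold oneDivAddMulGamma
  fun_prop

theorem oneDivAddMulGamma_neg_self (m : ℕ) :
    oneDivAddMulGamma m (-m) = (-1) ^ m * m.factorial := by
  have h : ∀ j ∈ Finset.range m, (-m + j : ℂ) = (-1) * ((m - j : ℕ) : ℂ) := fun j hj ↦ by
    rw [Nat.cast_sub (Finset.mem_range.1 hj).le]
    ring
  rw [oneDivAddMulGamma, Finset.prod_congr rfl h, Finset.prod_mul_distrib, ← Nat.cast_prod,
    ← Nat.descFactorial_eq_prod_range, Nat.descFactorial_self]
  simp

theorem oneDivAddMulGamma_neg_of_ne {k m : ℕ} (h : k ≠ m) :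
    oneDivAddMulGamma k (-m) = 0 := by
  have := add_mul_oneDivAddMulGamma k (-m)
  rw [Gamma_neg_nat_eq_zero, inv_zero] at this
  refine (mul_eq_zero.1 this).resolve_left fun h0 ↦ h ?_
  exact_mod_cast (neg_add_eq_zero.1 h0).symm

/-- `f` minus the polynomial `∑ k < n, c k * x ^ k` on `(0, 1]`. -/
noncomputable def subPolyIoc (f : ℝ → ℂ) (c : ℕ → ℂ) (n : ℕ) (x : ℝ) : ℂ :=
  f x - ∑ k ∈ Finset.range n, c k * (Ioc (0 : ℝ) 1).indicator (fun t : ℝ ↦ (t : ℂ) ^ (k : ℂ)) x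

theorem subPolyIoc_succ (f : ℝ → ℂ) (c : ℕ → ℂ) (n : ℕ) :
    subPolyIoc f c (n + 1) = fun x ↦ subPolyIoc f c n x -
      c n • (Ioc (0 : ℝ) 1).indicator (fun t : ℝ ↦ (t : ℂ) ^ (n : ℂ)) x := by
  ext x
  simp only [subPolyIoc, Finset.sum_range_succ, smul_eq_mul]
  ring

theorem hasMellin_subPolyIoc {f : ℝ → ℂ} {s : ℂ} (hs : 0 < s.re) (hf : MellinConvergent f s)
    (c : ℕ → ℂ) (n : ℕ) :
    HasMellin (subPolyIoc f c n) s (mellin f s - ∑ k ∈ Finset.range n, c k / (s + k)) := by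
  induction n with
  | zero =>
    have : subPolyIoc f c 0 = f := by ext x; simp [subPolyIoc]
    simpa [this, HasMellin] using hf
  | succ n ih =>
    have h1 := hasMellin_cpow_Ioc (n : ℂ) (s := s) (by simp; positivity)
    have h2 := hasMellin_const_smul h1.1 (c n)
    have h3 := hasMellin_sub ih.1 h2.1
    rw [subPolyIoc_succ]
    refine ⟨h3.1, h3.2.trans ?_⟩
    rw [h2.2, h1.2, ih.2, Finset.sum_range_succ, smul_eq_mul]
    ring

theorem locallyIntegrableOn_subPolyIoc {f : ℝ → ℂ} (hf : Continuous f) (c : ℕ → ℂ) (n : ℕ) :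
    LocallyIntegrableOn (subPolyIoc f c n) (Ioi 0) := by
  induction n with
  | zero =>
    have : subPolyIoc f c 0 = f := by ext x; simp [subPolyIoc]
    rw [this]
    exact hf.locallyIntegrable.locallyIntegrableOn _
  | succ n ih =>
    rw [subPolyIoc_succ]
    refine ih.sub (LocallyIntegrable.locallyIntegrableOn ?_ _)
    refine (Integrable.smul (c n) ?_).locallyIntegrable
    rw [integrable_indicator_iff measurableSet_Ioc]
    simp only [cpow_natCast]
    exact ((by fun_prop : Continuous fun t : ℝ ↦ (t : ℂ) ^ n).integrableOn_Icc).mono_set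
      Ioc_subset_Icc_self

theorem subPolyIoc_eventuallyEq_atTop (f : ℝ → ℂ) (c : ℕ → ℂ) (n : ℕ) :
    subPolyIoc f c n =ᶠ[atTop] f := by
  filter_upwards [eventually_gt_atTop 1] with x hx
  simp [subPolyIoc, hx.not_ge]

theorem subPolyIoc_eventuallyEq_nhdsGT_zero (f : ℝ → ℂ) (c : ℕ → ℂ) (n : ℕ) :
    subPolyIoc f c n =ᶠ[nhdsWithin 0 (Ioi 0)]
      fun x ↦ f x - ∑ k ∈ Finset.range n, c k * (x : ℂ) ^ k := by
  filter_upwards [Ioc_mem_nhdsGT zero_lt_one] with x hx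
  simp [subPolyIoc, indicator_of_mem hx]

theorem xplus_eq_mellin (f : ℝ → ℂ) (α : ℂ) :
    xplus f α = (Gamma (α + 1))⁻¹ * mellin f (α + 1) := by
  simp [xplus, mellin, mul_comm]

/-- The continuation of `xplus f`, when `c` lists the first `n` Taylor coefficients of `f` at `0`. -/
noncomputable def xplusExtension (f : ℝ → ℂ) (c : ℕ → ℂ) (n : ℕ) (α : ℂ) : ℂ :=
  (Gamma (α + 1))⁻¹ * mellin (subPolyIoc f c n) (α + 1) +
    ∑ k ∈ Finset.range n, c k * oneDivAddMulGamma k (α + 1)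

theorem differentiableAt_xplusExtension {f : ℝ → ℂ} (hf : Continuous f) {a b : ℝ} {c : ℕ → ℂ}
    {n : ℕ} {α : ℂ} (htop : f =O[atTop] fun x ↦ x ^ (-a))
    (hbot : (fun x : ℝ ↦ f x - ∑ k ∈ Finset.range n, c k * (x : ℂ) ^ k)
      =O[nhdsWithin 0 (Ioi 0)] fun x ↦ x ^ (-b))
    (hb : b - 1 < α.re) (ha : α.re < a - 1) :
    DifferentiableAt ℂ (xplusExtension f c n) α := by
  have h1 : DifferentiableAt ℂ (mellin (subPolyIoc f c n)) (α + 1) :=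
    mellin_differentiableAt_of_isBigO_rpow (locallyIntegrableOn_subPolyIoc hf c n)
      ((subPolyIoc_eventuallyEq_atTop f c n).trans_isBigO htop) (by simp; linarith)
      ((subPolyIoc_eventuallyEq_nhdsGT_zero f c n).trans_isBigO hbot) (by simp; linarith)
  have h2 : DifferentiableAt ℂ (fun z : ℂ ↦ mellin (subPolyIoc f c n) (z + 1)) α :=
    h1.comp α (f := fun z : ℂ ↦ z + 1) (by fun_prop)
  have h3 : DifferentiableAt ℂ (fun z : ℂ ↦ (Gamma (z + 1))⁻¹) α :=
    (differentiable_one_div_Gamma _).comp α (f := fun z : ℂ ↦ z + 1) (by fun_prop)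
  have h4 (k : ℕ) : DifferentiableAt ℂ (fun z : ℂ ↦ oneDivAddMulGamma k (z + 1)) α :=
    (differentiable_oneDivAddMulGamma k _).comp α (f := fun z : ℂ ↦ z + 1) (by fun_prop)
  unfold xplusExtension
  fun_prop

theorem xplusExtension_eq_xplus {f : ℝ → ℂ} {α : ℂ} (hα : -1 < α.re)
    (hf : MellinConvergent f (α + 1)) (c : ℕ → ℂ) (n : ℕ) :
    xplusExtension f c n α = xplus f α := by
  have hs : 0 < (α + 1).re := by simp; linarith
  have hk (k : ℕ) : c k * oneDivAddMulGamma k (α + 1) =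
      (Gamma (α + 1))⁻¹ * (c k / (α + 1 + k)) := by
    have h0 : α + 1 + k ≠ 0 := fun h ↦ by
      have := congrArg re h
      simp only [add_re, natCast_re, zero_re] at this hs
      have := k.cast_nonneg (α := ℝ)
      linarith
    rw [← add_mul_oneDivAddMulGamma k]
    field_simp
  rw [xplusExtension, xplus_eq_mellin, (hasMellin_subPolyIoc hs hf c n).2,
    Finset.sum_congr rfl fun k _ ↦ hk k, ← Finset.mul_sum]
  ring

theorem xplusExtension_neg_sub_one (f : ℝ → ℂ) (c : ℕ → ℂ) {m n : ℕ} (h : m < n) :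
    xplusExtension f c n (-m - 1) = (-1) ^ m * (m.factorial * c m) := by
  rw [xplusExtension, sub_add_cancel, Gamma_neg_nat_eq_zero, inv_zero, zero_mul, zero_add,
    Finset.sum_eq_single_of_mem m (Finset.mem_range.2 h)
      fun k _ hk ↦ by rw [oneDivAddMulGamma_neg_of_ne hk, mul_zero],
    oneDivAddMulGamma_neg_self]
  ring

theorem convex_verticalStrip (p q : ℝ) : Convex ℝ {z : ℂ | p < z.re ∧ z.re < q} :=
  (convex_halfSpace_re_gt p).inter (convex_halfSpace_re_lt q)

theorem isOpen_verticalStrip (p q : ℝ) : IsOpen {z : ℂ | p < z.re ∧ z.re < q} :=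
  (isOpen_lt continuous_const continuous_re).inter (isOpen_lt continuous_re continuous_const)

theorem DifferentiableOn.eqOn_verticalStrip {F G : ℂ → ℂ} {p p' q : ℝ} (hp : p ≤ p') (hq : p' < q)
    (hF : DifferentiableOn ℂ F {z | p < z.re ∧ z.re < q})
    (hG : DifferentiableOn ℂ G {z | p < z.re ∧ z.re < q})
    (h : ∀ z : ℂ, p' < z.re → z.re < q → F z = G z) :
    EqOn F G {z | p < z.re ∧ z.re < q} := by
  obtain ⟨x, hx, hx'⟩ := exists_between hq
  have hopen := isOpen_verticalStrip p q
  refine (hF.analyticOnNhd hopen).eqOn_of_preconnected_of_eventuallyEq (hG.analyticOnNhd hopen)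
    (convex_verticalStrip p q).isPreconnected (z₀ := x) ⟨by simpa using hp.trans_lt hx,
      by simpa using hx'⟩ ?_
  filter_upwards [(isOpen_verticalStrip p' q).mem_nhds (x := (x : ℂ)) ⟨by simpa using hx,
    by simpa using hx'⟩] with z hz
  exact h z hz.1 hz.2

theorem stmt_0 (a : ℝ) (ha : 0 < a) (l : ℕ) (ε : ℝ) (hε0 : 0 < ε) (hε1 : ε < 1)
    (f : ℝ → ℂ) (hfc : Continuous f)
    (hdecay : f =O[cocompact ℝ] fun x => |x| ^ (-a))
    (O : Set ℝ) (hO : IsOpen O) (h0O : (0 : ℝ) ∈ O)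
    (hCl : ContDiffOn ℝ l f O)
    (M : ℝ) (hHolder : ∀ x₁ ∈ O, ∀ x₂ ∈ O,
      ‖iteratedDerivWithin l f O x₁ - iteratedDerivWithin l f O x₂‖ ≤ M * |x₁ - x₂| ^ ε) :
    ∃ F : ℂ → ℂ,
      DifferentiableOn ℂ F {α : ℂ | -(l : ℝ) - ε - 1 < α.re ∧ α.re < a - 1} ∧
      (∀ α : ℂ, -1 < α.re → α.re < a - 1 → F α = xplus f α) ∧
      (∀ m : ℕ, m ≤ l → F (-(m : ℂ) - 1) = (-1) ^ m * iteratedDerivWithin m f O 0) ∧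
      (∀ G : ℂ → ℂ,
        DifferentiableOn ℂ G {α : ℂ | -(l : ℝ) - ε - 1 < α.re ∧ α.re < a - 1} →
        (∀ α : ℂ, -1 < α.re → α.re < a - 1 → G α = xplus f α) →
        EqOn G F {α : ℂ | -(l : ℝ) - ε - 1 < α.re ∧ α.re < a - 1}) := by
  have htop : f =O[atTop] fun x ↦ x ^ (-a) := by
    refine (hdecay.mono atTop_le_cocompact).congr' EventuallyEq.rfl ?_
    filter_upwards [eventually_ge_atTop 0] with x hx
    rw [abs_of_nonneg hx]
  let c : ℕ → ℂ := fun k ↦ (k.factorial : ℂ)⁻¹ * iteratedDerivWithin k f O 0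
  have hbot : (fun x : ℝ ↦ f x - ∑ k ∈ Finset.range (l + 1), c k * (x : ℂ) ^ k)
      =O[nhdsWithin 0 (Ioi 0)] fun x ↦ x ^ (-(-(l + ε))) := by
    have h := (taylor_isBigO_rpow_of_holder hε0.le hO h0O hCl
      fun x hx ↦ hHolder x hx 0 h0O).mono (nhdsWithin_le_nhds (s := Ioi 0))
    refine h.congr' (Eventually.of_forall fun x ↦ ?_) ?_
    · simp only [taylor_within_apply, c]
      congr 1
      refine Finset.sum_congr rfl fun k _ ↦ ?_
      simp only [sub_zero, real_smul, ofReal_mul, ofReal_inv, ofReal_natCast, ofReal_pow]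
      ring
    · filter_upwards [self_mem_nhdsWithin] with x hx
      rw [sub_zero, abs_of_pos hx, neg_neg]
  have hdiff : DifferentiableOn ℂ (xplusExtension f c (l + 1))
      {α : ℂ | -(l : ℝ) - ε - 1 < α.re ∧ α.re < a - 1} := fun α hα ↦
    (differentiableAt_xplusExtension hfc htop hbot (by linarith [hα.1])
      hα.2).differentiableWithinAt
  have heq (α : ℂ) (h1 : -1 < α.re) (h2 : α.re < a - 1) :
      xplusExtension f c (l + 1) α = xplus f α := by
    refine xplusExtension_eq_xplus h1 ?_ c _
    refine mellinConvergent_of_isBigO_rpow (b := 0)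
      (hfc.locallyIntegrable.locallyIntegrableOn _) htop (by simp; linarith) ?_
      (by simp; linarith)
    simpa using (hfc.tendsto 0).isBigO_one ℝ |>.mono nhdsWithin_le_nhds
  refine ⟨xplusExtension f c (l + 1), hdiff, heq, fun m hm ↦ ?_, fun G hG hGeq ↦ ?_⟩
  · rw [xplusExtension_neg_sub_one f c (Nat.lt_succ_of_le hm),
      mul_inv_cancel_left₀ (by exact_mod_cast m.factorial_ne_zero)]
  · have hl := l.cast_nonneg (α := ℝ)
    exact hG.eqOn_verticalStrip (p' := -1) (by linarith) (by linarith) hdiff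
      fun α h1 h2 ↦ (hGeq α h1 h2).trans (heq α h1 h2).symm
end

section
/- Let a > 0, l ∈ ℕ₀, 0 < ε < 1, and n ∈ ℕ. Let f : ℝⁿ → ℂ be continuous with f(x) = O(|x|^{-a}) as |x| → ∞, and assume f is C^l on some neighborhood of 0 ∈ ℝⁿ with every l-th order partial derivative Hölder continuous of index ε on that neighborhood. Then the mean value function M_f : ℝ → ℂ is continuous with M_f(t) = O(|t|^{-a}) as |t| → ∞, and M_f is C^l on some neighborhood of 0 ∈ ℝ with M_f^{(l)} Hölder continuous of index ε on that neighborhood. -/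
open Complex MeasureTheory Filter Asymptotics Set Metric

/-- `Ω_n = 2π^(n/2)/Γ(n/2)`, the total surface measure of the unit sphere `S^{n-1} ⊆ ℝⁿ`. -/
noncomputable def sphereArea (n : ℕ) : ℝ := 2 * Real.pi ^ ((n : ℝ) / 2) / Real.Gamma ((n : ℝ) / 2)

/-- The mean value function `M_f(t) = (1/Ω_n) ∫_{S^{n-1}} f(tω) dω`, where `dω` is the
rotation-invariant surface measure on the unit sphere (here `volume.toSphere`). -/
noncomputable def meanValue (n : ℕ) (f : EuclideanSpace ℝ (Fin n) → ℂ) (t : ℝ) : ℂ :=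
  (sphereArea n : ℂ)⁻¹ *
    ∫ ω : Metric.sphere (0 : EuclideanSpace ℝ (Fin n)) 1,
      f (t • (ω : EuclideanSpace ℝ (Fin n)))
      ∂((volume : Measure (EuclideanSpace ℝ (Fin n))).toSphere)

/-- If successive members of a finite sequence of functions are derivatives of one another on an
open set, they are the iterated derivatives of the first one. -/
theorem iteratedDerivWithin_eqOn_of_hasDerivAt {F : Type*} [NormedAddCommGroup F]
    [NormedSpace ℝ F] {U : Set ℝ} (hU : IsOpen U) {l : ℕ} {g : ℕ → ℝ → F}
    (hg : ∀ k < l, ∀ t ∈ U, HasDerivAt (g k) (g (k + 1) t) t) {k : ℕ} (hk : k ≤ l) :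
    EqOn (iteratedDerivWithin k (g 0) U) (g k) U := by
  induction k with
  | zero => intro t _; simp
  | succ k ih =>
    intro t ht
    rw [iteratedDerivWithin_succ, derivWithin_congr (ih (by omega)) (ih (by omega) ht),
      derivWithin_of_isOpen hU ht, (hg k (by omega) t ht).deriv]

theorem contDiffOn_of_hasDerivAt_chain {F : Type*} [NormedAddCommGroup F]
    [NormedSpace ℝ F] {U : Set ℝ} (hU : IsOpen U) {l : ℕ} {g : ℕ → ℝ → F}
    (hg : ∀ k < l, ∀ t ∈ U, HasDerivAt (g k) (g (k + 1) t) t) (hl : ContinuousOn (g l) U) :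
    ContDiffOn ℝ l (g 0) U := by
  rw [contDiffOn_nat_iff_continuousOn_differentiableOn_deriv hU.uniqueDiffOn]
  refine ⟨fun m hm => ?_, fun m hm => ?_⟩
  · refine ContinuousOn.congr ?_ (iteratedDerivWithin_eqOn_of_hasDerivAt hU hg hm)
    rcases hm.lt_or_eq with h | rfl
    · exact fun t ht => (hg m h t ht).continuousAt.continuousWithinAt
    · exact hl
  · refine DifferentiableOn.congr ?_ (iteratedDerivWithin_eqOn_of_hasDerivAt hU hg hm.le)
    exact fun t ht => (hg m hm t ht).differentiableAt.differentiableWithinAt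

section SphereIntegral

variable {E : Type*} [NormedAddCommGroup E] [NormedSpace ℝ E]

/-- The `k`-th derivative of `s ↦ f (s • ω)` at `t`, integrated over the unit sphere. -/
noncomputable def sphereIntegralDeriv [MeasurableSpace E] (μ : Measure (sphere (0 : E) 1))
    (f : E → ℂ) (k : ℕ) (t : ℝ) : ℂ :=
  ∫ ω : sphere (0 : E) 1, iteratedFDeriv ℝ k f (t • (ω : E)) (fun _ => (ω : E)) ∂μ

theorem norm_apply_sphere_le {k : ℕ} (A : E [×k]→L[ℝ] ℂ) (ω : sphere (0 : E) 1) :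
    ‖A (fun _ => (ω : E))‖ ≤ ‖A‖ := by
  simpa using A.le_opNorm (fun _ => (ω : E))

theorem norm_smul_sphere (t : ℝ) (ω : sphere (0 : E) 1) : ‖t • (ω : E)‖ = |t| := by
  simp [norm_smul]

variable {f : E → ℂ} {O : Set E} {l k : ℕ} {r : ℝ}

theorem ContDiffOn.continuousOn_iteratedFDeriv_of_isOpen (hO : IsOpen O)
    (hf : ContDiffOn ℝ l f O) (hk : k ≤ l) : ContinuousOn (iteratedFDeriv ℝ k f) O :=
  (hf.continuousOn_iteratedFDerivWithin (by exact_mod_cast hk) hO.uniqueDiffOn).congr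
    fun _ hx => (iteratedFDerivWithin_of_isOpen k hO hx).symm

theorem continuousOn_iteratedFDeriv_smul_apply (hO : IsOpen O) (hf : ContDiffOn ℝ l f O)
    (hk : k ≤ l) :
    ContinuousOn (fun p : ℝ × E => iteratedFDeriv ℝ k f (p.1 • p.2) (fun _ => p.2))
      {p | p.1 • p.2 ∈ O} := by
  have h1 : ContinuousOn (fun p : ℝ × E => iteratedFDeriv ℝ k f (p.1 • p.2))
      {p | p.1 • p.2 ∈ O} :=
    (hf.continuousOn_iteratedFDeriv_of_isOpen hO hk).comp (by fun_prop) fun _ hp => hp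
  have h2 : Continuous fun q : (E [×k]→L[ℝ] ℂ) × (Fin k → E) => q.1 q.2 :=
    continuous_eval
  exact h2.comp_continuousOn
    (h1.prodMk (continuous_pi fun _ => continuous_snd).continuousOn)

theorem hasDerivAt_iteratedFDeriv_smul_apply (hO : IsOpen O) (hf : ContDiffOn ℝ l f O)
    (hk : k < l) {t : ℝ} {v : E} (ht : t • v ∈ O) :
    HasDerivAt (fun s : ℝ => iteratedFDeriv ℝ k f (s • v) (fun _ => v))
      (iteratedFDeriv ℝ (k + 1) f (t • v) (fun _ => v)) t := by
  have hd := ((hf.contDiffAt (hO.mem_nhds ht)).differentiableAt_iteratedFDeriv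
    (m := k) (by exact_mod_cast hk)).hasFDerivAt
  have hs : HasDerivAt (fun s : ℝ => s • v) v t := by
    simpa using (hasDerivAt_id t).smul_const v
  have := (ContinuousMultilinearMap.apply ℝ (fun _ : Fin k => E) ℂ
    (fun _ => v)).hasFDerivAt.comp_hasDerivAt t (hd.comp_hasDerivAt t hs)
  rw [iteratedFDeriv_succ_apply_left]
  exact this

theorem smul_sphere_mem_closedBall {t : ℝ} (ht : t ∈ ball (0 : ℝ) r) (ω : sphere (0 : E) 1) :
    t • (ω : E) ∈ closedBall (0 : E) r := by
  rw [mem_closedBall_zero_iff, norm_smul_sphere]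
  exact (mem_ball_zero_iff.1 ht).le

theorem continuous_iteratedFDeriv_smul_sphere (hO : IsOpen O) (hf : ContDiffOn ℝ l f O)
    (hr : closedBall 0 r ⊆ O) (hk : k ≤ l) {t : ℝ} (ht : t ∈ ball (0 : ℝ) r) :
    Continuous fun ω : sphere (0 : E) 1 =>
      iteratedFDeriv ℝ k f (t • (ω : E)) (fun _ => (ω : E)) :=
  (continuousOn_iteratedFDeriv_smul_apply hO hf hk).comp_continuous
    (f := fun ω : sphere (0 : E) 1 => (t, (ω : E))) (by fun_prop)
    fun ω => hr (smul_sphere_mem_closedBall ht ω)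

variable [FiniteDimensional ℝ E]

theorem exists_norm_iteratedFDeriv_le (hO : IsOpen O) (hf : ContDiffOn ℝ l f O)
    (hr : closedBall 0 r ⊆ O) (hk : k ≤ l) :
    ∃ C, ∀ x ∈ closedBall (0 : E) r, ‖iteratedFDeriv ℝ k f x‖ ≤ C :=
  have := FiniteDimensional.proper_real E
  (isCompact_closedBall 0 r).exists_bound_of_continuousOn
    ((hf.continuousOn_iteratedFDeriv_of_isOpen hO hk).mono hr)

variable [MeasurableSpace E] {μ : Measure (sphere (0 : E) 1)} [IsFiniteMeasure μ]

theorem isBigO_integral_smul_sphere {a : ℝ}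
    (hf : f =O[cocompact E] fun x => ‖x‖ ^ (-a)) :
    (fun t : ℝ => ∫ ω : sphere (0 : E) 1, f (t • (ω : E)) ∂μ)
      =O[cocompact ℝ] fun t => |t| ^ (-a) := by
  have := FiniteDimensional.proper_real E
  obtain ⟨C, hC⟩ := hf.bound
  rw [← cobounded_eq_cocompact, hasBasis_cobounded_norm.eventually_iff] at hC
  obtain ⟨R, -, hR⟩ := hC
  refine IsBigO.of_bound (C * μ.real univ) ?_
  rw [← cobounded_eq_cocompact, hasBasis_cobounded_norm.eventually_iff]
  refine ⟨R, trivial, fun t ht => ?_⟩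
  rw [mul_right_comm]
  refine norm_integral_le_of_norm_le_const (.of_forall fun ω => ?_)
  have h := hR (x := t • (ω : E)) (by simpa [norm_smul] using ht)
  rwa [norm_smul_sphere] at h

variable [BorelSpace E]

theorem integrable_iteratedFDeriv_smul_sphere (hO : IsOpen O) (hf : ContDiffOn ℝ l f O)
    (hr : closedBall 0 r ⊆ O) (hk : k ≤ l) {t : ℝ} (ht : t ∈ ball (0 : ℝ) r) :
    Integrable (fun ω : sphere (0 : E) 1 =>
      iteratedFDeriv ℝ k f (t • (ω : E)) (fun _ => (ω : E))) μ := by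
  have := FiniteDimensional.proper_real E
  exact (continuous_iteratedFDeriv_smul_sphere hO hf hr hk ht).integrable_of_hasCompactSupport
    (HasCompactSupport.of_compactSpace _)

theorem hasDerivAt_sphereIntegralDeriv (hO : IsOpen O) (hf : ContDiffOn ℝ l f O)
    (hr : closedBall 0 r ⊆ O) (hk : k < l) {t : ℝ} (ht : t ∈ ball (0 : ℝ) r) :
    HasDerivAt (sphereIntegralDeriv μ f k) (sphereIntegralDeriv μ f (k + 1) t) t := by
  obtain ⟨C, hC⟩ := exists_norm_iteratedFDeriv_le hO hf hr (k := k + 1) hk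
  have hnhds := isOpen_ball.mem_nhds ht
  refine (hasDerivAt_integral_of_dominated_loc_of_deriv_le (bound := fun _ => C)
    (F' := fun (s : ℝ) (ω : sphere (0 : E) 1) =>
      iteratedFDeriv ℝ (k + 1) f (s • (ω : E)) (fun _ => (ω : E))) hnhds
    ?_ (integrable_iteratedFDeriv_smul_sphere hO hf hr hk.le ht)
    (integrable_iteratedFDeriv_smul_sphere hO hf hr hk ht).aestronglyMeasurable
    ?_ (integrable_const C) ?_).2
  · filter_upwards [hnhds] with s hs
    exact (integrable_iteratedFDeriv_smul_sphere hO hf hr hk.le hs).aestronglyMeasurable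
  · exact .of_forall fun ω s hs => (norm_apply_sphere_le _ ω).trans
      (hC _ (smul_sphere_mem_closedBall hs ω))
  · exact .of_forall fun ω s hs =>
      hasDerivAt_iteratedFDeriv_smul_apply hO hf hk (hr (smul_sphere_mem_closedBall hs ω))

theorem continuousOn_sphereIntegralDeriv (hO : IsOpen O) (hf : ContDiffOn ℝ l f O)
    (hr : closedBall 0 r ⊆ O) (hk : k ≤ l) :
    ContinuousOn (sphereIntegralDeriv μ f k) (ball 0 r) := by
  obtain ⟨C, hC⟩ := exists_norm_iteratedFDeriv_le hO hf hr hk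
  refine continuousOn_of_dominated (bound := fun _ => C) ?_ ?_ (integrable_const C) ?_
  · exact fun s hs =>
      (integrable_iteratedFDeriv_smul_sphere hO hf hr hk hs).aestronglyMeasurable
  · exact fun s hs => .of_forall fun ω => (norm_apply_sphere_le _ ω).trans
      (hC _ (smul_sphere_mem_closedBall hs ω))
  · exact .of_forall fun ω => (continuousOn_iteratedFDeriv_smul_apply hO hf hk).comp
      (f := fun s : ℝ => (s, (ω : E))) (by fun_prop)
      fun s hs => hr (smul_sphere_mem_closedBall hs ω)

theorem norm_sphereIntegralDeriv_sub_le (hO : IsOpen O) (hf : ContDiffOn ℝ l f O)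
    (hr : closedBall 0 r ⊆ O) {M ε : ℝ}
    (hM : ∀ x₁ ∈ O, ∀ x₂ ∈ O,
      ‖iteratedFDerivWithin ℝ l f O x₁ - iteratedFDerivWithin ℝ l f O x₂‖ ≤ M * ‖x₁ - x₂‖ ^ ε)
    {t₁ t₂ : ℝ} (ht₁ : t₁ ∈ ball (0 : ℝ) r) (ht₂ : t₂ ∈ ball (0 : ℝ) r) :
    ‖sphereIntegralDeriv μ f l t₁ - sphereIntegralDeriv μ f l t₂‖ ≤
      M * |t₁ - t₂| ^ ε * μ.real univ := by
  rw [sphereIntegralDeriv, sphereIntegralDeriv,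
    ← integral_sub (integrable_iteratedFDeriv_smul_sphere hO hf hr le_rfl ht₁)
      (integrable_iteratedFDeriv_smul_sphere hO hf hr le_rfl ht₂)]
  refine norm_integral_le_of_norm_le_const (.of_forall fun ω => ?_)
  have h₁ := hr (smul_sphere_mem_closedBall ht₁ ω)
  have h₂ := hr (smul_sphere_mem_closedBall ht₂ ω)
  have h := hM _ h₁ _ h₂
  rw [iteratedFDerivWithin_of_isOpen l hO h₁, iteratedFDerivWithin_of_isOpen l hO h₂,
    ← sub_smul, norm_smul_sphere] at h
  exact (norm_apply_sphere_le (iteratedFDeriv ℝ l f (t₁ • (ω : E)) -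
    iteratedFDeriv ℝ l f (t₂ • (ω : E))) ω).trans h

theorem continuous_integral_smul_sphere (hf : Continuous f) :
    Continuous fun t : ℝ => ∫ ω : sphere (0 : E) 1, f (t • (ω : E)) ∂μ := by
  have := FiniteDimensional.proper_real E
  simpa using continuous_parametric_integral_of_continuous (μ := μ)
    (f := fun (t : ℝ) (ω : sphere (0 : E) 1) => f (t • (ω : E))) (by fun_prop) isCompact_univ

end SphereIntegral

theorem stmt_2 (a : ℝ) (ha : 0 < a) (l : ℕ) (ε : ℝ) (hε0 : 0 < ε) (hε1 : ε < 1) (n : ℕ)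
    (hn : 0 < n)
    (f : EuclideanSpace ℝ (Fin n) → ℂ) (hfc : Continuous f)
    (hdecay : f =O[cocompact (EuclideanSpace ℝ (Fin n))] fun x => ‖x‖ ^ (-a))
    (O : Set (EuclideanSpace ℝ (Fin n))) (hO : IsOpen O)
    (h0O : (0 : EuclideanSpace ℝ (Fin n)) ∈ O)
    (hCl : ContDiffOn ℝ l f O)
    (M : ℝ) (hHolder : ∀ x₁ ∈ O, ∀ x₂ ∈ O,
      ‖iteratedFDerivWithin ℝ l f O x₁ - iteratedFDerivWithin ℝ l f O x₂‖ ≤ M * ‖x₁ - x₂‖ ^ ε) :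
    Continuous (meanValue n f) ∧
    ((meanValue n f) =O[cocompact ℝ] fun t => |t| ^ (-a)) ∧
    ∃ O' : Set ℝ, IsOpen O' ∧ (0 : ℝ) ∈ O' ∧
      ContDiffOn ℝ l (meanValue n f) O' ∧
      ∃ M' : ℝ, ∀ t₁ ∈ O', ∀ t₂ ∈ O',
        ‖iteratedDerivWithin l (meanValue n f) O' t₁ -
          iteratedDerivWithin l (meanValue n f) O' t₂‖ ≤ M' * |t₁ - t₂| ^ ε := by
  set μ := (volume : Measure (EuclideanSpace ℝ (Fin n))).toSphere
  refine ⟨continuous_const.mul (continuous_integral_smul_sphere hfc),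
    (isBigO_integral_smul_sphere hdecay).const_mul_left _, ?_⟩
  obtain ⟨r, hr0, hr⟩ := nhds_basis_closedBall.mem_iff.1 (hO.mem_nhds h0O)
  let g : ℕ → ℝ → ℂ := fun k t => (sphereArea n : ℂ)⁻¹ * sphereIntegralDeriv μ f k t
  have hg0 : meanValue n f = g 0 := by
    funext t
    simp [g, meanValue, sphereIntegralDeriv, μ]
  have hg : ∀ k < l, ∀ t ∈ ball (0 : ℝ) r, HasDerivAt (g k) (g (k + 1) t) t :=
    fun k hk t ht => (hasDerivAt_sphereIntegralDeriv hO hCl hr hk ht).const_mul _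
  refine ⟨ball 0 r, isOpen_ball, mem_ball_self hr0, ?_,
    ‖(sphereArea n : ℂ)⁻¹‖ * (M * μ.real univ), fun t₁ ht₁ t₂ ht₂ => ?_⟩
  · rw [hg0]
    exact contDiffOn_of_hasDerivAt_chain isOpen_ball hg
      (continuousOn_const.mul (continuousOn_sphereIntegralDeriv hO hCl hr le_rfl))
  · have heq := iteratedDerivWithin_eqOn_of_hasDerivAt isOpen_ball hg le_rfl
    rw [hg0, heq ht₁, heq ht₂, ← mul_sub, norm_mul, mul_assoc, mul_right_comm]
    gcongr
    exact norm_sphereIntegralDeriv_sub_le hO hCl hr hHolder ht₁ ht₂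
end

section
/- Let a > 0, l ∈ ℕ₀, 0 < ε < 1, and n ∈ ℕ. Let f : ℝⁿ → ℂ be continuous with f(x) = O(|x|^{-a}) as |x| → ∞, and assume f is C^l on some neighborhood of 0 with every l-th order partial derivative Hölder continuous of index ε there. Then the map α ↦ r^α(f) = (1/Γ(α+n)) ∫_{ℝⁿ} |x|^α f(x) dx, initially defined for -n < Re α < a - n, extends uniquely to a holomorphic function F on the strip {α ∈ ℂ : -l - ε - n < Re α < a - n}, and F(α) = Ω_n (-1)^{-α-n} M_f^{(-α-n)}(0) for every integer α ∈ {-l-n, …, -n}, where M_f is the mean value function of f around 0. -/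
open Complex MeasureTheory Filter Asymptotics Set Metric

/-- `r^α(f) = (1/Γ(α+n)) ∫_{ℝⁿ} ‖x‖^α f(x) dx`. -/
noncomputable def rmap (n : ℕ) (f : EuclideanSpace ℝ (Fin n) → ℂ) (α : ℂ) : ℂ :=
  (Complex.Gamma (α + n))⁻¹ * ∫ x : EuclideanSpace ℝ (Fin n), (‖x‖ : ℂ) ^ α * f x

section MellinExtension

theorem hasMellin_indicator_sum_pow (c : ℕ → ℂ) (N : ℕ) {s : ℂ} (hs : 0 < s.re) :
    HasMellin ((Ioc (0 : ℝ) 1).indicator fun t => ∑ k ∈ Finset.range N, c k * (t : ℂ) ^ k) s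
      (∑ k ∈ Finset.range N, c k * (1 / (s + k))) := by
  induction N with
  | zero => simp [HasMellin, MellinConvergent, mellin]
  | succ N ih =>
    have hN : HasMellin ((Ioc (0 : ℝ) 1).indicator fun t => (t : ℂ) ^ (N : ℂ)) s (1 / (s + N)) :=
      hasMellin_cpow_Ioc N (by simpa using by positivity)
    have hcN := hasMellin_const_smul hN.1 (c N)
    have h := hasMellin_add ih.1 hcN.1
    rw [ih.2, hcN.2, hN.2, smul_eq_mul] at h
    rw [Finset.sum_range_succ]
    convert h using 1
    ext t
    by_cases ht : t ∈ Ioc (0 : ℝ) 1 <;> simp [ht, Finset.sum_range_succ]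

theorem inv_Gamma_mul_one_div_add_nat (k : ℕ) {s : ℂ} (hs : 0 < s.re) :
    (Gamma s)⁻¹ * (1 / (s + k)) =
      (∏ j ∈ Finset.range k, (s + j)) * (Gamma (s + k + 1))⁻¹ := by
  have hne (j : ℕ) : s + j ≠ 0 := fun h => by
    have := congrArg re h
    simp at this
    have : (0 : ℝ) ≤ j := j.cast_nonneg
    linarith
  have hG (j : ℕ) : Gamma (s + j) = (∏ i ∈ Finset.range j, (s + i)) * Gamma s := by
    induction j with
    | zero => simp
    | succ j ih =>
      rw [Finset.prod_range_succ, Nat.cast_succ, ← add_assoc, Gamma_add_one _ (hne j), ih]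
      ring
  have hG' := hG (k + 1)
  rw [Nat.cast_succ, ← add_assoc, Finset.prod_range_succ] at hG'
  rw [hG']
  have h1 : (∏ i ∈ Finset.range k, (s + i)) ≠ 0 := Finset.prod_ne_zero_iff.2 fun i _ => hne i
  have h2 := hne k
  have h3 := Gamma_ne_zero_of_re_pos hs
  field_simp

theorem prod_mul_inv_Gamma_at_neg_nat (k m : ℕ) :
    (∏ j ∈ Finset.range k, (-(m : ℂ) + j)) * (Gamma (-(m : ℂ) + k + 1))⁻¹ =
      if k = m then (-1) ^ m * (m.factorial : ℂ) else 0 := by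
  rcases lt_trichotomy k m with h | h | h
  · obtain ⟨d, rfl⟩ := Nat.exists_eq_add_of_lt h
    have : -((k + d + 1 : ℕ) : ℂ) + k + 1 = -(d : ℂ) := by push_cast; ring
    rw [this, Gamma_neg_nat_eq_zero, if_neg h.ne]
    simp
  · subst h
    simp only [neg_add_cancel, zero_add, Gamma_one, inv_one, mul_one, if_true]
    have h1 : ∀ j ∈ Finset.range k, (-(k : ℂ) + j) = (-1) * ((k - j : ℕ) : ℂ) := fun j hj => by
      rw [Nat.cast_sub (Finset.mem_range.1 hj).le]
      ring
    rw [Finset.prod_congr rfl h1, Finset.prod_mul_distrib, Finset.prod_const, Finset.card_range,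
      ← Nat.cast_prod]
    congr 2
    rw [← Nat.descFactorial_self, Nat.descFactorial_eq_prod_range]
  · rw [if_neg h.ne', Finset.prod_eq_zero (Finset.mem_range.2 h) (by simp), zero_mul]

/-- If `φ` has an asymptotic expansion `∑ k ≤ l, c k * t ^ k` at `0` with error `O(t ^ (l + ε))`,
then the normalized Mellin transform of `φ` extends to `-l - ε < re s`, with explicit values at
the nonpositive integers. -/
theorem exists_extension_inv_Gamma_mul_mellin {φ : ℝ → ℂ} {a ε : ℝ} {l : ℕ} (c : ℕ → ℂ)
    (hφ : LocallyIntegrableOn φ (Ioi 0)) (hε : 0 < ε)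
    (htop : φ =O[atTop] fun t => t ^ (-a))
    (hbot : (fun t : ℝ => φ t - ∑ k ∈ Finset.range (l + 1), c k * (t : ℂ) ^ k)
      =O[nhdsWithin 0 (Ioi 0)] fun t => t ^ ((l : ℝ) + ε)) :
    ∃ H : ℂ → ℂ, DifferentiableOn ℂ H {s | -(l : ℝ) - ε < s.re ∧ s.re < a} ∧
      (∀ s : ℂ, 0 < s.re → s.re < a → H s = (Gamma s)⁻¹ * mellin φ s) ∧
      ∀ m : ℕ, m ≤ l → H (-m) = (-1) ^ m * (m.factorial : ℂ) * c m := by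
  set P : ℝ → ℂ := fun t => ∑ k ∈ Finset.range (l + 1), c k * (t : ℂ) ^ k with hP
  have hPcont : Continuous P := by fun_prop
  set ψ : ℝ → ℂ := fun t => φ t - (Ioc (0 : ℝ) 1).indicator P t with hψ
  have hPint : Integrable ((Ioc (0 : ℝ) 1).indicator P) :=
    (integrable_indicator_iff measurableSet_Ioc).2
      (hPcont.integrableOn_Icc.mono_set Ioc_subset_Icc_self)
  have hψloc : LocallyIntegrableOn ψ (Ioi 0) :=
    hφ.sub (hPint.locallyIntegrable.locallyIntegrableOn _)
  have hψtop : ψ =O[atTop] fun t => t ^ (-a) := by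
    refine htop.congr' ?_ EventuallyEq.rfl
    filter_upwards [eventually_gt_atTop 1] with t ht
    simp [hψ, ht]
  have hψbot : ψ =O[nhdsWithin 0 (Ioi 0)] fun t => t ^ (-(-((l : ℝ) + ε))) := by
    rw [neg_neg]
    refine hbot.congr' ?_ EventuallyEq.rfl
    filter_upwards [Ioc_mem_nhdsGT (zero_lt_one' ℝ)] with t ht
    simp only [hψ, indicator_of_mem ht, hP]
  refine ⟨fun s => (Gamma s)⁻¹ * mellin ψ s + ∑ k ∈ Finset.range (l + 1),
    c k * ((∏ j ∈ Finset.range k, (s + j)) * (Gamma (s + k + 1))⁻¹), ?_, ?_, ?_⟩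
  · intro s hs
    have h1 : DifferentiableAt ℂ (mellin ψ) s :=
      mellin_differentiableAt_of_isBigO_rpow hψloc hψtop hs.2 hψbot (by linarith [hs.1])
    have h2 (k : ℕ) : DifferentiableAt ℂ (fun s : ℂ => (Gamma (s + k + 1))⁻¹) s :=
      (differentiable_one_div_Gamma.comp (by fun_prop : Differentiable ℂ
        fun s : ℂ => s + k + 1)).differentiableAt
    exact DifferentiableAt.differentiableWithinAt <|
      ((differentiable_one_div_Gamma s).mul h1).add <| DifferentiableAt.fun_sum fun k _ =>
        (DifferentiableAt.mul (by fun_prop) (h2 k)).const_mul _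
  · intro s hs0 hsa
    have hψc : MellinConvergent ψ s :=
      mellinConvergent_of_isBigO_rpow hψloc hψtop hsa hψbot (by
        have : (0 : ℝ) ≤ l := l.cast_nonneg
        linarith)
    have hPm := hasMellin_indicator_sum_pow c (l + 1) hs0
    have h := (hasMellin_add hψc hPm.1).2
    rw [hPm.2] at h
    have hmellin : mellin φ s =
        mellin ψ s + ∑ k ∈ Finset.range (l + 1), c k * (1 / (s + k)) := by
      rw [← h]
      congr 1
      ext t
      simp [hψ, hP]
    rw [hmellin, mul_add, Finset.mul_sum]
    refine congrArg _ (Finset.sum_congr rfl fun k _ => ?_)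
    rw [← inv_Gamma_mul_one_div_add_nat k hs0]
    ring
  · intro m hm
    simp only [prod_mul_inv_Gamma_at_neg_nat, Gamma_neg_nat_eq_zero, inv_zero, zero_mul, zero_add,
      mul_ite, mul_zero, Finset.sum_ite_eq', Finset.mem_range]
    rw [if_pos (by omega)]
    ring

end MellinExtension

section Polar

variable {E F : Type*} [NormedAddCommGroup E] [NormedSpace ℝ E] [MeasurableSpace E]
  [FiniteDimensional ℝ E] [BorelSpace E] [Nontrivial E] [NormedAddCommGroup F] [NormedSpace ℝ F]

theorem integral_eq_integral_Ioi_integral_toSphere (μ : Measure E) [μ.IsAddHaarMeasure]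
    {g : E → F} (hg : Integrable g μ) :
    ∫ x, g x ∂μ = ∫ t in Ioi (0 : ℝ), t ^ (Module.finrank ℝ E - 1) •
      ∫ ω : sphere (0 : E) 1, g (t • (ω : E)) ∂μ.toSphere := by
  have hmp := μ.measurePreserving_homeomorphUnitSphereProd
  have hemb := (homeomorphUnitSphereProd E).measurableEmbedding
  let G : sphere (0 : E) 1 × Ioi (0 : ℝ) → F := fun p => g ((p.2 : ℝ) • (p.1 : E))
  have hG : G ∘ homeomorphUnitSphereProd E = g ∘ Subtype.val := by
    funext x
    have hx : ‖(x : E)‖ ≠ 0 := norm_ne_zero_iff.2 x.2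
    simp [G, smul_smul, hx]
  have hGint : Integrable G (μ.toSphere.prod (.volumeIoiPow (Module.finrank ℝ E - 1))) := by
    rw [← hmp.integrable_comp_emb hemb, hG,
      ← integrableOn_iff_comap_subtypeVal (measurableSet_singleton _).compl, IntegrableOn,
      restrict_compl_singleton]
    exact hg
  calc
    ∫ x, g x ∂μ = ∫ x : ({0}ᶜ : Set E), g x ∂(μ.comap (↑)) := by
      rw [integral_subtype_comap (measurableSet_singleton _).compl fun x ↦ g x,
        restrict_compl_singleton]
    _ = ∫ p, G p ∂μ.toSphere.prod (.volumeIoiPow (Module.finrank ℝ E - 1)) := by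
      rw [← hmp.integral_comp hemb]
      exact integral_congr_ae (.of_forall fun x => (congrFun hG x).symm)
    _ = ∫ t : Ioi (0 : ℝ), ∫ ω : sphere (0 : E) 1, g ((t : ℝ) • (ω : E)) ∂μ.toSphere
          ∂.volumeIoiPow (Module.finrank ℝ E - 1) := integral_prod_symm _ hGint
    _ = _ := by
      simp only [Measure.volumeIoiPow, ENNReal.ofReal]
      rw [integral_withDensity_eq_integral_smul
          (measurable_subtype_coe.pow_const _).real_toNNReal,
        integral_subtype_comap measurableSet_Ioi fun t : ℝ ↦
          Real.toNNReal (t ^ (Module.finrank ℝ E - 1)) •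
            ∫ ω : sphere (0 : E) 1, g (t • (ω : E)) ∂μ.toSphere]
      refine setIntegral_congr_fun measurableSet_Ioi fun t ht => ?_
      simp only [NNReal.smul_def, Real.coe_toNNReal _ (pow_nonneg (le_of_lt ht) _)]

omit [MeasurableSpace E] [BorelSpace E] [Nontrivial E] in
theorem exists_norm_le_one_add_norm_rpow {f : E → F} {a : ℝ} (hf : Continuous f)
    (ha : 0 ≤ a) (hdecay : f =O[cocompact E] fun x => ‖x‖ ^ (-a)) :
    ∃ C, ∀ x, ‖f x‖ ≤ C * (1 + ‖x‖) ^ (-a) := by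
  have hO : (fun x => (1 + ‖x‖) ^ a • f x) =O[cocompact E] fun _ => (1 : ℝ) := by
    have h1 : (fun x : E => (1 + ‖x‖) ^ a) =O[cocompact E] fun x => ‖x‖ ^ a := by
      refine IsBigO.of_bound (2 ^ a) ?_
      filter_upwards [(tendsto_norm_cocompact_atTop (E := E)).eventually_ge_atTop 1] with x hx
      rw [Real.norm_of_nonneg (by positivity), Real.norm_of_nonneg (by positivity),
        ← Real.mul_rpow (by norm_num) (by positivity)]
      gcongr
      linarith
    refine (h1.smul hdecay).congr' EventuallyEq.rfl ?_
    filter_upwards [(tendsto_norm_cocompact_atTop (E := E)).eventually_ge_atTop 1] with x hx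
    rw [smul_eq_mul, ← Real.rpow_add (by linarith), add_neg_cancel, Real.rpow_zero]
  obtain ⟨C₁, hC₁⟩ := hO.bound
  obtain ⟨K, hK, hKC⟩ := mem_cocompact.1 hC₁
  have hcont : Continuous fun x : E => (1 + ‖x‖) ^ a • f x :=
    ((continuous_const.add continuous_norm).rpow_const fun x => Or.inr ha).smul hf
  obtain ⟨C₂, hC₂⟩ := hK.exists_bound_of_continuousOn hcont.continuousOn
  refine ⟨max C₁ C₂, fun x => ?_⟩
  have hx : (0 : ℝ) < 1 + ‖x‖ := by positivity
  have hle : ‖(1 + ‖x‖) ^ a • f x‖ ≤ max C₁ C₂ := by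
    by_cases hxK : x ∈ K
    · exact (hC₂ x hxK).trans (le_max_right _ _)
    · have := hKC hxK
      simp only [mem_ofPred_eq, norm_one, mul_one] at this
      exact this.trans (le_max_left _ _)
  rw [norm_smul, Real.norm_of_nonneg (by positivity)] at hle
  rw [Real.rpow_neg hx.le, ← div_eq_mul_inv, le_div_iff₀ (by positivity)]
  linarith

theorem integrable_norm_cpow_mul (μ : Measure E) [μ.IsAddHaarMeasure] {f : E → ℂ} {a : ℝ}
    (hf : Continuous f) (ha : 0 ≤ a) (hdecay : f =O[cocompact E] fun x => ‖x‖ ^ (-a)) {α : ℂ}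
    (hα : -(Module.finrank ℝ E : ℝ) < α.re) (hα' : α.re < a - Module.finrank ℝ E) :
    Integrable (fun x => (‖x‖ : ℂ) ^ α * f x) μ := by
  obtain ⟨C, hC⟩ := exists_norm_le_one_add_norm_rpow hf ha hdecay
  have hcont : Continuous fun t : ℝ => (1 + |t|) ^ (-a) :=
    (by fun_prop : Continuous fun t : ℝ => 1 + |t|).rpow_const fun t => Or.inl (by positivity)
  have hint : IntegrableOn (fun t : ℝ => t ^ (α.re + Module.finrank ℝ E - 1) * (1 + |t|) ^ (-a))
      (Ioi 0) := by
    refine mellin_convergent_of_isBigO_scalar (a := a) (b := 0)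
      (hcont.locallyIntegrable.locallyIntegrableOn _) ?_ (by linarith) ?_ (by linarith)
    · refine IsBigO.of_bound 1 ?_
      filter_upwards [eventually_gt_atTop 0] with t ht
      rw [Real.norm_of_nonneg (by positivity), Real.norm_of_nonneg (by positivity), one_mul]
      exact Real.rpow_le_rpow_of_nonpos ht (by linarith [le_abs_self t]) (by linarith)
    · simp only [neg_zero, Real.rpow_zero]
      exact (hcont.tendsto 0).mono_left nhdsWithin_le_nhds |>.isBigO_one ℝ
  have hdim : 0 < Module.finrank ℝ E := Module.finrank_pos
  have hmaj : Integrable (fun x : E => (fun t : ℝ => t ^ α.re * (1 + |t|) ^ (-a)) ‖x‖) μ := by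
    rw [integrable_fun_norm_addHaar μ (f := fun t : ℝ => t ^ α.re * (1 + |t|) ^ (-a))]
    refine hint.congr_fun (fun t ht => ?_) measurableSet_Ioi
    have ht : 0 < t := ht
    have : α.re + Module.finrank ℝ E - 1 = ((Module.finrank ℝ E - 1 : ℕ) : ℝ) + α.re := by
      rw [Nat.cast_pred hdim]
      ring
    simp only [smul_eq_mul]
    rw [this, Real.rpow_add ht, Real.rpow_natCast, mul_assoc]
  refine (hmaj.const_mul C).mono' ?_ ?_
  · refine AEStronglyMeasurable.mul (Measurable.aestronglyMeasurable ?_) hf.aestronglyMeasurable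
    exact (measurable_norm.complex_ofReal).pow_const α
  · have h0 : ∀ᵐ x ∂μ, x ≠ 0 := by
      rw [ae_iff]
      simp
    filter_upwards [h0] with x hx
    have hx : 0 < ‖x‖ := norm_pos_iff.2 hx
    rw [norm_mul, norm_cpow_eq_rpow_re_of_pos hx, abs_norm]
    calc ‖x‖ ^ α.re * ‖f x‖ ≤ ‖x‖ ^ α.re * (C * (1 + ‖x‖) ^ (-a)) := by gcongr; exact hC x
      _ = _ := by ring

theorem integral_norm_cpow_mul_eq_mellin (μ : Measure E) [μ.IsAddHaarMeasure] {f : E → ℂ} {a : ℝ}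
    (hf : Continuous f) (ha : 0 ≤ a) (hdecay : f =O[cocompact E] fun x => ‖x‖ ^ (-a)) {α : ℂ}
    (hα : -(Module.finrank ℝ E : ℝ) < α.re) (hα' : α.re < a - Module.finrank ℝ E) :
    ∫ x, (‖x‖ : ℂ) ^ α * f x ∂μ =
      mellin (fun t => ∫ ω : sphere (0 : E) 1, f (t • (ω : E)) ∂μ.toSphere)
        (α + Module.finrank ℝ E) := by
  rw [integral_eq_integral_Ioi_integral_toSphere μ
    (integrable_norm_cpow_mul μ hf ha hdecay hα hα'), mellin]
  refine setIntegral_congr_fun measurableSet_Ioi fun t ht => ?_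
  have ht : 0 < t := ht
  have hnorm (ω : sphere (0 : E) 1) : ‖t • (ω : E)‖ = t := by
    simp [norm_smul, abs_of_pos ht]
  have hexp : α + Module.finrank ℝ E - 1 = α + ((Module.finrank ℝ E - 1 : ℕ) : ℂ) := by
    rw [Nat.cast_pred Module.finrank_pos]
    ring
  simp only [hnorm, integral_const_mul, real_smul, smul_eq_mul]
  rw [hexp, cpow_add _ _ (ofReal_ne_zero.2 ht.ne'), cpow_natCast]
  push_cast
  ring

omit [Nontrivial E] in
theorem isBigO_atTop_integral_toSphere (μ : Measure E) [μ.IsAddHaarMeasure] {f : E → F} {a : ℝ}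
    (hdecay : f =O[cocompact E] fun x => ‖x‖ ^ (-a)) :
    (fun t : ℝ => ∫ ω : sphere (0 : E) 1, f (t • (ω : E)) ∂μ.toSphere)
      =O[atTop] fun t => t ^ (-a) := by
  obtain ⟨C, hC⟩ := hdecay.bound
  rw [← Metric.cobounded_eq_cocompact, ← comap_norm_atTop, eventually_comap] at hC
  refine IsBigO.of_bound (C * μ.toSphere.real univ) ?_
  filter_upwards [hC, eventually_gt_atTop 0] with t ht ht0
  have h (ω : sphere (0 : E) 1) : ‖f (t • (ω : E))‖ ≤ C * ‖t ^ (-a)‖ := by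
    have hn : ‖t • (ω : E)‖ = t := by simp [norm_smul, abs_of_pos ht0]
    simpa only [hn] using ht _ hn
  refine (norm_integral_le_of_norm_le_const (.of_forall h)).trans_eq ?_
  ring

omit [Nontrivial E] in
theorem continuous_integral_toSphere_smul (μ : Measure E) [μ.IsAddHaarMeasure] {f : E → F}
    (hf : Continuous f) :
    Continuous fun t : ℝ => ∫ ω : sphere (0 : E) 1, f (t • (ω : E)) ∂μ.toSphere := by
  have := continuous_parametric_integral_of_continuous (μ := μ.toSphere)
    (f := fun (t : ℝ) (ω : sphere (0 : E) 1) => f (t • (ω : E)))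
    (by simp only [Function.uncurry_def]; fun_prop) isCompact_univ
  simpa using this

end Polar

section Taylor

theorem norm_sub_taylor_le {E : Type*} [NormedAddCommGroup E] [NormedSpace ℝ E] {δ C ε : ℝ}
    (hC : 0 ≤ C) (hε : 0 ≤ ε) (l : ℕ) (g : ℕ → ℝ → E)
    (hg : ∀ k < l, ∀ t ∈ Ico 0 δ, HasDerivAt (g k) (g (k + 1) t) t)
    (hl : ∀ t ∈ Ico 0 δ, ‖g l t - g l 0‖ ≤ C * t ^ ε) :
    ∀ t ∈ Ico 0 δ,
      ‖g 0 t - ∑ k ∈ Finset.range (l + 1), (t ^ k / k.factorial) • g k 0‖ ≤ C * t ^ (l + ε) := by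
  induction l generalizing g with
  | zero => simpa using hl
  | succ l ih =>
    intro T hT
    have ih' := ih (fun k => g (k + 1)) (fun k hk => hg (k + 1) (by omega)) hl
    set r : ℝ → E := fun t =>
      g 0 t - ∑ k ∈ Finset.range (l + 1 + 1), (t ^ k / k.factorial) • g k 0 with hr
    have hr0 : r 0 = 0 := by simp [hr, Finset.sum_range_succ']
    have hder (t : ℝ) (ht : t ∈ Icc 0 T) : HasDerivAt r
        (g 1 t - ∑ k ∈ Finset.range (l + 1), (t ^ k / k.factorial) • g (k + 1) 0) t := by
      have hsum : HasDerivAt (fun t : ℝ => ∑ k ∈ Finset.range (l + 1),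
          (t ^ (k + 1) / (k + 1).factorial) • g (k + 1) 0)
          (∑ k ∈ Finset.range (l + 1), (t ^ k / k.factorial) • g (k + 1) 0) t := by
        refine HasDerivAt.fun_sum fun k _ => HasDerivAt.smul_const ?_ _
        convert (hasDerivAt_pow (k + 1) t).div_const ((k + 1).factorial : ℝ) using 1
        rw [Nat.factorial_succ]
        have : (k.factorial : ℝ) ≠ 0 := by positivity
        push_cast
        field_simp
      have h0 := hg 0 (by omega) t ⟨ht.1, ht.2.trans_lt hT.2⟩
      simp only [hr, Finset.sum_range_succ' _ (l + 1), pow_zero, Nat.factorial_zero]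
      exact h0.sub (hsum.add_const _)
    have hbound (t : ℝ) (ht : t ∈ Icc 0 T) :
        ‖g 1 t - ∑ k ∈ Finset.range (l + 1), (t ^ k / k.factorial) • g (k + 1) 0‖ ≤
          C * T ^ (l + ε) := by
      refine (ih' t ⟨ht.1, ht.2.trans_lt hT.2⟩).trans ?_
      gcongr
      exacts [ht.1, ht.2]
    have := (convex_Icc 0 T).norm_image_sub_le_of_norm_hasDerivWithin_le
      (fun t ht => (hder t ht).hasDerivWithinAt) hbound (left_mem_Icc.2 hT.1)
      (right_mem_Icc.2 hT.1)
    rw [hr0, sub_zero, sub_zero, Real.norm_of_nonneg hT.1, mul_assoc] at this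
    refine this.trans_eq ?_
    rw [Nat.cast_succ, add_right_comm, Real.rpow_add_one' hT.1 (by positivity)]

theorem iteratedDeriv_eq_of_hasDerivAt {E : Type*} [NormedAddCommGroup E] [NormedSpace ℝ E]
    {U : Set ℝ} (hU : IsOpen U) {l : ℕ} {g : ℕ → ℝ → E}
    (hg : ∀ k < l, ∀ t ∈ U, HasDerivAt (g k) (g (k + 1) t) t) :
    ∀ m ≤ l, ∀ t ∈ U, iteratedDeriv m (g 0) t = g m t := by
  intro m
  induction m with
  | zero => simp
  | succ m ih =>
    intro hm t ht
    rw [iteratedDeriv_succ]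
    have : iteratedDeriv m (g 0) =ᶠ[nhds t] g m :=
      eventually_of_mem (hU.mem_nhds ht) (ih (by omega))
    rw [this.deriv_eq, (hg m hm t ht).deriv]

end Taylor

section RadialDerivative

variable {E F : Type*} [NormedAddCommGroup E] [NormedSpace ℝ E] [NormedAddCommGroup F]
  [NormedSpace ℝ F] {f : E → F} {O : Set E} {δ : ℝ} {l : ℕ}

theorem smul_sphere_mem (hδO : closedBall 0 δ ⊆ O) {t : ℝ} (ht : |t| < δ)
    (ω : sphere (0 : E) 1) : t • (ω : E) ∈ O :=
  hδO (by simpa [norm_smul] using ht.le)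

theorem continuous_iteratedFDerivWithin_radial (hO : IsOpen O) (hf : ContDiffOn ℝ l f O)
    (hδO : closedBall 0 δ ⊆ O) {k : ℕ} (hk : k ≤ l) {t : ℝ} (ht : |t| < δ) :
    Continuous fun ω : sphere (0 : E) 1 =>
      iteratedFDerivWithin ℝ k f O (t • (ω : E)) fun _ => (ω : E) := by
  have h1 : Continuous fun ω : sphere (0 : E) 1 => iteratedFDerivWithin ℝ k f O (t • (ω : E)) :=
    (hf.continuousOn_iteratedFDerivWithin (mod_cast hk) hO.uniqueDiffOn).comp_continuous
      (by fun_prop) (smul_sphere_mem hδO ht)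
  fun_prop

theorem hasDerivAt_iteratedFDerivWithin_radial (hO : IsOpen O) (hf : ContDiffOn ℝ l f O)
    {k : ℕ} (hk : k < l) (v : E) {t : ℝ} (ht : t • v ∈ O) :
    HasDerivAt (fun t : ℝ => iteratedFDerivWithin ℝ k f O (t • v) fun _ => v)
      (iteratedFDerivWithin ℝ (k + 1) f O (t • v) fun _ => v) t := by
  have h1 : HasFDerivAt (iteratedFDerivWithin ℝ k f O)
      (fderivWithin ℝ (iteratedFDerivWithin ℝ k f O) O (t • v)) (t • v) :=
    ((hf.differentiableOn_iteratedFDerivWithin (mod_cast hk) hO.uniqueDiffOn _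
      ht).hasFDerivWithinAt).hasFDerivAt (hO.mem_nhds ht)
  have h2 : HasDerivAt (fun t : ℝ => t • v) v t := by
    simpa using (hasDerivAt_id t).smul_const v
  have h3 := (ContinuousMultilinearMap.apply ℝ (fun _ : Fin k => E) F
    fun _ => v).hasFDerivAt.comp_hasDerivAt t (h1.comp_hasDerivAt t h2)
  exact h3

theorem hasDerivAt_integral_iteratedFDerivWithin_radial [FiniteDimensional ℝ E]
    [MeasurableSpace E] [BorelSpace E]
    (ν : Measure (sphere (0 : E) 1)) [IsFiniteMeasure ν]
    (hO : IsOpen O) (hf : ContDiffOn ℝ l f O) (hδO : closedBall 0 δ ⊆ O) {k : ℕ} (hk : k < l)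
    {t : ℝ} (ht : |t| < δ) :
    HasDerivAt
      (fun t : ℝ => ∫ ω, iteratedFDerivWithin ℝ k f O (t • (ω : E)) (fun _ => (ω : E)) ∂ν)
      (∫ ω, iteratedFDerivWithin ℝ (k + 1) f O (t • (ω : E)) (fun _ => (ω : E)) ∂ν) t := by
  have hball : {s : ℝ | |s| < δ} ∈ nhds t := (isOpen_lt continuous_abs continuous_const).mem_nhds ht
  obtain ⟨B, hB⟩ := (isCompact_closedBall (0 : E) δ).exists_bound_of_continuousOn
    ((hf.continuousOn_iteratedFDerivWithin (m := k + 1) (mod_cast hk) hO.uniqueDiffOn).mono hδO)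
  refine (hasDerivAt_integral_of_dominated_loc_of_deriv_le (μ := ν) (bound := fun _ => B)
    (F := fun t ω => iteratedFDerivWithin ℝ k f O (t • (ω : E)) fun _ => (ω : E))
    (F' := fun t ω => iteratedFDerivWithin ℝ (k + 1) f O (t • (ω : E)) fun _ => (ω : E))
    hball ?_ ?_ ?_ ?_ (integrable_const B) ?_).2
  · filter_upwards [hball] with s hs
    exact (continuous_iteratedFDerivWithin_radial hO hf hδO hk.le hs).aestronglyMeasurable
  · exact (continuous_iteratedFDerivWithin_radial hO hf hδO hk.le
      ht).integrable_of_hasCompactSupport (HasCompactSupport.of_compactSpace _)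
  · exact (continuous_iteratedFDerivWithin_radial hO hf hδO hk ht).aestronglyMeasurable
  · refine .of_forall fun ω s hs => ?_
    have hs : |s| < δ := hs
    refine (ContinuousMultilinearMap.le_opNorm _ _).trans ?_
    simpa using hB (s • (ω : E)) (by simpa [norm_smul] using hs.le)
  · exact .of_forall fun ω s hs =>
      hasDerivAt_iteratedFDerivWithin_radial hO hf hk _ (smul_sphere_mem hδO hs ω)

theorem norm_integral_iteratedFDerivWithin_radial_sub_le [FiniteDimensional ℝ E]
    [MeasurableSpace E] [BorelSpace E]
    (ν : Measure (sphere (0 : E) 1)) [IsFiniteMeasure ν]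
    (hO : IsOpen O) (hf : ContDiffOn ℝ l f O) (hδO : closedBall 0 δ ⊆ O) {M ε : ℝ}
    (hHolder : ∀ x₁ ∈ O, ∀ x₂ ∈ O,
      ‖iteratedFDerivWithin ℝ l f O x₁ - iteratedFDerivWithin ℝ l f O x₂‖ ≤ M * ‖x₁ - x₂‖ ^ ε)
    {t : ℝ} (ht0 : 0 ≤ t) (ht : t < δ) :
    ‖∫ ω, iteratedFDerivWithin ℝ l f O (t • (ω : E)) (fun _ => (ω : E)) ∂ν -
      ∫ ω, iteratedFDerivWithin ℝ l f O ((0 : ℝ) • (ω : E)) (fun _ => (ω : E)) ∂ν‖ ≤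
      |M| * ν.real univ * t ^ ε := by
  have ht' : |t| < δ := by rwa [abs_of_nonneg ht0]
  have h0' : |(0 : ℝ)| < δ := by rw [abs_zero]; exact ht0.trans_lt ht
  have hint {s : ℝ} (hs : |s| < δ) : Integrable (fun ω : sphere (0 : E) 1 =>
      iteratedFDerivWithin ℝ l f O (s • (ω : E)) fun _ => (ω : E)) ν :=
    (continuous_iteratedFDerivWithin_radial hO hf hδO le_rfl
      hs).integrable_of_hasCompactSupport (HasCompactSupport.of_compactSpace _)
  rw [← integral_sub (hint ht') (hint h0')]
  have hb (ω : sphere (0 : E) 1) :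
      ‖iteratedFDerivWithin ℝ l f O (t • (ω : E)) (fun _ => (ω : E)) -
        iteratedFDerivWithin ℝ l f O ((0 : ℝ) • (ω : E)) (fun _ => (ω : E))‖ ≤ |M| * t ^ ε := by
    rw [← sub_apply]
    refine (ContinuousMultilinearMap.le_opNorm _ _).trans ?_
    have := hHolder _ (smul_sphere_mem hδO ht' ω) _ (smul_sphere_mem hδO h0' ω)
    rw [zero_smul, sub_zero, norm_smul, norm_eq_of_mem_sphere, mul_one,
      Real.norm_of_nonneg ht0] at this
    simp only [zero_smul, norm_eq_of_mem_sphere, Finset.prod_const_one, mul_one]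
    exact this.trans (by gcongr; exact le_abs_self M)
  refine (norm_integral_le_of_norm_le_const (.of_forall hb)).trans_eq ?_
  ring

end RadialDerivative

theorem toSphere_real_univ_eq_sphereArea {n : ℕ} (hn : 0 < n) :
    (volume : Measure (EuclideanSpace ℝ (Fin n))).toSphere.real univ = sphereArea n := by
  have : Nonempty (Fin n) := ⟨⟨0, hn⟩⟩
  have hn' : (0 : ℝ) < n := Nat.cast_pos.2 hn
  rw [Measure.toSphere_real_apply_univ, measureReal_def, EuclideanSpace.volume_ball,
    finrank_euclideanSpace_fin, Fintype.card_fin, sphereArea, Real.Gamma_add_one (by positivity)]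
  have hG : 0 < Real.Gamma ((n : ℝ) / 2) := Real.Gamma_pos_of_pos (by positivity)
  rw [ENNReal.ofReal_one, one_pow, one_mul, ENNReal.toReal_ofReal (by positivity),
    ← Real.rpow_natCast, Real.sqrt_eq_rpow, ← Real.rpow_mul Real.pi_pos.le]
  field_simp

theorem sphereArea_pos {n : ℕ} (hn : 0 < n) : 0 < sphereArea n := by
  have hn' : (0 : ℝ) < n := Nat.cast_pos.2 hn
  have := Real.Gamma_pos_of_pos (half_pos hn')
  unfold sphereArea
  positivity

theorem stmt_3 (a : ℝ) (ha : 0 < a) (l : ℕ) (ε : ℝ) (hε0 : 0 < ε) (hε1 : ε < 1) (n : ℕ)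
    (hn : 0 < n)
    (f : EuclideanSpace ℝ (Fin n) → ℂ) (hfc : Continuous f)
    (hdecay : f =O[cocompact (EuclideanSpace ℝ (Fin n))] fun x => ‖x‖ ^ (-a))
    (O : Set (EuclideanSpace ℝ (Fin n))) (hO : IsOpen O)
    (h0O : (0 : EuclideanSpace ℝ (Fin n)) ∈ O)
    (hCl : ContDiffOn ℝ l f O)
    (M : ℝ) (hHolder : ∀ x₁ ∈ O, ∀ x₂ ∈ O,
      ‖iteratedFDerivWithin ℝ l f O x₁ - iteratedFDerivWithin ℝ l f O x₂‖ ≤ M * ‖x₁ - x₂‖ ^ ε) :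
    ∃ F : ℂ → ℂ,
      DifferentiableOn ℂ F {α : ℂ | -(l : ℝ) - ε - n < α.re ∧ α.re < a - n} ∧
      (∀ α : ℂ, -(n : ℝ) < α.re → α.re < a - n → F α = rmap n f α) ∧
      (∀ m : ℕ, m ≤ l →
        F (-(m : ℂ) - n) = (sphereArea n : ℂ) * (-1) ^ m * iteratedDeriv m (meanValue n f) 0) ∧
      (∀ G : ℂ → ℂ,
        DifferentiableOn ℂ G {α : ℂ | -(l : ℝ) - ε - n < α.re ∧ α.re < a - n} →
        (∀ α : ℂ, -(n : ℝ) < α.re → α.re < a - n → G α = rmap n f α) →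
        EqOn G F {α : ℂ | -(l : ℝ) - ε - n < α.re ∧ α.re < a - n}) := by

  have : Nonempty (Fin n) := ⟨⟨0, hn⟩⟩
  obtain ⟨δ, hδ, hδO⟩ := nhds_basis_closedBall.mem_iff.1 (hO.mem_nhds h0O)
  set ν := (volume : Measure (EuclideanSpace ℝ (Fin n))).toSphere
  set g : ℕ → ℝ → ℂ := fun k t => ∫ ω : sphere (0 : EuclideanSpace ℝ (Fin n)) 1,
    iteratedFDerivWithin ℝ k f O (t • (ω : EuclideanSpace ℝ (Fin n))) (fun _ => ↑ω) ∂ν with hg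
  set φ : ℝ → ℂ := fun t => ∫ ω : sphere (0 : EuclideanSpace ℝ (Fin n)) 1,
    f (t • (ω : EuclideanSpace ℝ (Fin n))) ∂ν with hφ
  have hg0 : g 0 = φ := by
    simp [hg, hφ]
  have hderiv (k : ℕ) (hk : k < l) (t : ℝ) (ht : t ∈ ball (0 : ℝ) δ) :
      HasDerivAt (g k) (g (k + 1) t) t :=
    hasDerivAt_integral_iteratedFDerivWithin_radial ν hO hCl hδO hk (by simpa using ht)
  have hmem (t : ℝ) (ht : t ∈ Ico 0 δ) : t ∈ ball (0 : ℝ) δ := by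
    simpa [abs_of_nonneg ht.1] using ht.2
  have htaylor := norm_sub_taylor_le (C := |M| * ν.real univ) (by positivity) hε0.le l g
    (fun k hk t ht => hderiv k hk t (hmem t ht)) fun t ht =>
      norm_integral_iteratedFDerivWithin_radial_sub_le ν hO hCl hδO hHolder ht.1 ht.2
  have hiter := iteratedDeriv_eq_of_hasDerivAt isOpen_ball hderiv
  rw [hg0] at htaylor hiter
  have hbot : (fun t : ℝ => φ t - ∑ k ∈ Finset.range (l + 1),
      (g k 0 / k.factorial) * (t : ℂ) ^ k) =O[nhdsWithin 0 (Ioi 0)] fun t => t ^ ((l : ℝ) + ε) := by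
    refine IsBigO.of_bound (|M| * ν.real univ) ?_
    filter_upwards [Ioo_mem_nhdsGT hδ] with t ht
    rw [Real.norm_of_nonneg (Real.rpow_nonneg ht.1.le _)]
    refine (congrArg (fun S => ‖φ t - S‖) (Finset.sum_congr rfl fun k _ => ?_)).trans_le
      (htaylor t ⟨ht.1.le, ht.2⟩)
    rw [real_smul]
    push_cast
    ring
  have hφc : Continuous φ := continuous_integral_toSphere_smul volume hfc
  obtain ⟨H, hHd, hHm, hHv⟩ := exists_extension_inv_Gamma_mul_mellin
    (fun k => g k 0 / k.factorial) (hφc.locallyIntegrable.locallyIntegrableOn _) hε0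
    (isBigO_atTop_integral_toSphere volume hdecay) hbot
  have hFd : DifferentiableOn ℂ (fun α : ℂ => H (α + n))
      {α : ℂ | -(l : ℝ) - ε - n < α.re ∧ α.re < a - n} := by
    refine hHd.comp (by fun_prop) fun α hα => ?_
    simp only [mem_ofPred_eq, add_re, natCast_re] at hα ⊢
    exact ⟨by linarith [hα.1], by linarith [hα.2]⟩
  have hFr (α : ℂ) (h1 : -(n : ℝ) < α.re) (h2 : α.re < a - n) : H (α + n) = _root_.rmap n f α := by
    rw [hHm _ (by simp; linarith) (by simp; linarith), _root_.rmap,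
      integral_norm_cpow_mul_eq_mellin volume hfc ha.le hdecay (by simpa using h1)
        (by simpa using h2), finrank_euclideanSpace_fin]
  refine ⟨fun α => H (α + n), hFd, hFr, fun m hm => ?_, fun G hGd hGr => ?_⟩
  · have hM : meanValue n f = fun t => (sphereArea n : ℂ)⁻¹ * φ t := rfl
    have hs : (sphereArea n : ℂ) ≠ 0 := ofReal_ne_zero.2 (sphereArea_pos hn).ne'
    have hm0 : (m.factorial : ℂ) ≠ 0 := Nat.cast_ne_zero.2 m.factorial_ne_zero
    rw [hM, iteratedDeriv_const_mul_field, hiter m hm 0 (mem_ball_self hδ)]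
    simp only [sub_add_cancel, hHv m hm]
    field_simp
  · have hopen (b c : ℝ) : IsOpen {α : ℂ | b < α.re ∧ α.re < c} :=
      (isOpen_lt continuous_const continuous_re).inter (isOpen_lt continuous_re continuous_const)
    have hconn : IsPreconnected {α : ℂ | -(l : ℝ) - ε - n < α.re ∧ α.re < a - n} :=
      ((convex_halfSpace_re_gt _).inter (convex_halfSpace_re_lt _)).isPreconnected
    have hz : -(n : ℝ) < ((a / 2 - n : ℝ) : ℂ).re ∧ ((a / 2 - n : ℝ) : ℂ).re < a - n := by
      rw [ofReal_re]
      constructor <;> linarith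
    have hl : (0 : ℝ) ≤ l := l.cast_nonneg
    refine (hGd.analyticOnNhd (hopen _ _)).eqOn_of_preconnected_of_eventuallyEq
      (hFd.analyticOnNhd (hopen _ _)) hconn (z₀ := ((a / 2 - n : ℝ) : ℂ))
      ⟨by linarith [hz.1], hz.2⟩ ?_
    filter_upwards [(hopen _ _).mem_nhds hz] with α hα
    rw [hGr α hα.1 hα.2, hFr α hα.1 hα.2]
end

section
/- Let a > 0, l ∈ ℕ₀, 0 < ε < 1, n ∈ ℕ and x ∈ ℝⁿ. Let f : ℝⁿ → ℂ be continuous with f(x) = O(|x|^{-a}), and assume f is C^l on a neighborhood of x with every l-th order partial derivative Hölder continuous of index ε there. Then there exists a function F holomorphic on {α ∈ ℂ : -l - ε < Re α < a} \ (n + 2ℕ₀) such that F(α) = (I^α f)(x) = (1/H_n(α)) ∫_{ℝⁿ} f(y)|x - y|^{α-n} dy whenever 0 < Re α < a and α ∉ n + 2ℕ₀, and such that at every point p ∈ (n + 2ℕ₀) with -l - ε < p < a the singularity of F is at worst a simple pole, i.e. α ↦ (α - p)F(α) extends holomorphically across p. -/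
open Complex MeasureTheory Filter Asymptotics Set Metric

/-- `H_n(α) = 2^α π^(n/2) Γ(α/2) / Γ((n-α)/2)`. -/
noncomputable def Hfun (n : ℕ) (α : ℂ) : ℂ :=
  (2 : ℂ) ^ α * (Real.pi : ℂ) ^ ((n : ℂ) / 2) * Complex.Gamma (α / 2) /
    Complex.Gamma (((n : ℂ) - α) / 2)

/-- The Riesz potential `(I^α f)(x) = (1/H_n(α)) ∫_{ℝⁿ} f(y) |x-y|^{α-n} dy`. -/
noncomputable def riesz (n : ℕ) (f : EuclideanSpace ℝ (Fin n) → ℂ) (α : ℂ)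
    (x : EuclideanSpace ℝ (Fin n)) : ℂ :=
  (Hfun n α)⁻¹ * ∫ y : EuclideanSpace ℝ (Fin n), f y * (‖x - y‖ : ℂ) ^ (α - n)

/-- The set `n + 2ℕ₀ ⊆ ℂ` of zeros of `H_n`. -/
def poleSet (n : ℕ) : Set ℂ := {α : ℂ | ∃ m : ℕ, α = (n : ℂ) + 2 * m}

open scoped Topology

lemma norm_sub_taylor_sum_le {F : Type*} [NormedAddCommGroup F] [NormedSpace ℝ F]
    {C ε δ : ℝ} (hC : 0 ≤ C) (hε : 0 < ε) (l : ℕ) (g : ℕ → ℝ → F)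
    (hg : ∀ j < l, ∀ t ∈ Icc 0 δ, HasDerivAt (g j) (g (j + 1) t) t)
    (hl : ∀ t ∈ Icc 0 δ, ‖g l t - g l 0‖ ≤ C * t ^ ε) :
    ∀ t ∈ Icc 0 δ,
      ‖g 0 t - ∑ j ∈ Finset.range (l + 1), (t ^ j / (j.factorial : ℝ)) • g j 0‖
        ≤ C * t ^ ((l : ℝ) + ε) := by
  induction l generalizing g with
  | zero => simpa using hl
  | succ l ih =>
    intro t ht
    have key := ih (fun j => g (j + 1)) (fun j hj => hg (j + 1) (by omega)) hl
    set h : ℝ → F := fun s => g 0 s -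
      ∑ j ∈ Finset.range (l + 2), (s ^ j / (j.factorial : ℝ)) • g j 0 with hh
    have hsub : Icc 0 t ⊆ Icc 0 δ := Icc_subset_Icc_right ht.2
    have hderiv : ∀ s ∈ Icc 0 t, HasDerivWithinAt h (g 1 s -
        ∑ j ∈ Finset.range (l + 1), (s ^ j / (j.factorial : ℝ)) • g (j + 1) 0) (Icc 0 t) s := by
      intro s hs
      refine ((hg 0 (by omega) s (hsub hs)).sub ?_).hasDerivWithinAt
      have : HasDerivAt (fun s : ℝ => ∑ j ∈ Finset.range (l + 2),
          (s ^ j / (j.factorial : ℝ)) • g j 0)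
          (∑ j ∈ Finset.range (l + 2),
            (((j : ℝ) * s ^ (j - 1)) / (j.factorial : ℝ)) • g j 0) s :=
        HasDerivAt.fun_sum fun j _ => ((hasDerivAt_pow j s).div_const _).smul_const _
      convert! this using 1
      rw [Finset.sum_range_succ' _ (l + 1)]
      simp only [Nat.cast_zero, zero_mul, zero_div, zero_smul, add_zero]
      refine Finset.sum_congr rfl fun j _ => ?_
      congr 1
      rw [Nat.factorial_succ]
      push_cast
      have : (j.factorial : ℝ) ≠ 0 := by positivity
      have h2 : (j : ℝ) + 1 ≠ 0 := by positivity
      field_simp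
    have hb := norm_image_sub_le_of_norm_deriv_le_segment' hderiv
      (C := C * t ^ ((l : ℝ) + ε)) (fun s hs => (key s (hsub ⟨hs.1, hs.2.le⟩)).trans
        (by gcongr; exacts [hs.1, hs.2.le])) t (right_mem_Icc.2 ht.1)
    have h0 : h 0 = 0 := by
      simp [hh, Finset.sum_range_succ' _ (l + 1)]
    rw [h0, sub_zero, sub_zero] at hb
    refine hb.trans_eq ?_
    rw [mul_assoc]
    congr 1
    rcases ht.1.eq_or_lt with rfl | h
    · rw [mul_zero, Real.zero_rpow (by positivity)]
    · rw [← Real.rpow_add_one h.ne']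
      congr 1
      push_cast
      ring

lemma exists_norm_sub_taylor_le {E F : Type*} [NormedAddCommGroup E] [NormedSpace ℝ E]
    [NormedAddCommGroup F] [NormedSpace ℝ F] {f : E → F} {O : Set E} (hO : IsOpen O) {x : E}
    (hx : x ∈ O) {l : ℕ} (hf : ContDiffOn ℝ l f O) {M ε : ℝ} (hε : 0 < ε)
    (hM : ∀ x₁ ∈ O, ∀ x₂ ∈ O,
      ‖iteratedFDerivWithin ℝ l f O x₁ - iteratedFDerivWithin ℝ l f O x₂‖ ≤ M * ‖x₁ - x₂‖ ^ ε) :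
    ∃ δ > 0, ∀ v : E, ‖v‖ < δ →
      ‖f (x + v) - ∑ j ∈ Finset.range (l + 1),
        (1 / (j.factorial : ℝ)) • iteratedFDerivWithin ℝ j f O x (fun _ => v)‖
        ≤ |M| * ‖v‖ ^ ((l : ℝ) + ε) := by
  obtain ⟨δ, hδ, hball⟩ := Metric.isOpen_iff.1 hO x hx
  refine ⟨δ, hδ, fun v hv => ?_⟩
  have hmem : ∀ t ∈ Icc (0 : ℝ) 1, x + t • v ∈ O := by
    intro t ht
    apply hball
    rw [mem_ball_iff_norm, add_sub_cancel_left, norm_smul, Real.norm_of_nonneg ht.1]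
    exact (mul_le_of_le_one_left (norm_nonneg _) ht.2).trans_lt hv
  have key := norm_sub_taylor_sum_le (C := |M| * ‖v‖ ^ ((l : ℝ) + ε)) (δ := 1) (by positivity)
    hε l (fun j t => iteratedFDerivWithin ℝ j f O (x + t • v) (fun _ => v)) ?_ ?_ 1 (by simp)
  · simpa using key
  · intro j hj t ht
    have h1 : HasFDerivAt (iteratedFDerivWithin ℝ j f O)
        (fderivWithin ℝ (iteratedFDerivWithin ℝ j f O) O (x + t • v)) (x + t • v) :=
      ((hf.differentiableOn_iteratedFDerivWithin (by exact_mod_cast hj) hO.uniqueDiffOn _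
        (hmem t ht)).hasFDerivWithinAt).hasFDerivAt (hO.mem_nhds (hmem t ht))
    have h2 : HasDerivAt (fun t : ℝ => x + t • v) v t := by
      simpa using ((hasDerivAt_id t).smul_const v).const_add x
    have h3 := (h1.comp_hasDerivAt t h2)
    exact (ContinuousMultilinearMap.apply ℝ (fun _ : Fin j => E) F
      (fun _ => v)).hasFDerivAt.comp_hasDerivAt t h3
  · intro t ht
    rw [← sub_apply]
    refine (ContinuousMultilinearMap.le_opNorm _ _).trans ?_
    have := hM _ (hmem t ht) _ (hmem 0 (by simp))
    simp only [Finset.prod_const, Finset.card_univ, Fintype.card_fin]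
    calc _ ≤ (M * ‖x + t • v - (x + (0 : ℝ) • v)‖ ^ ε) * ‖v‖ ^ l := by gcongr
      _ = M * (t ^ ε * ‖v‖ ^ ε) * ‖v‖ ^ l := by
        rw [zero_smul, add_zero, add_sub_cancel_left, norm_smul, Real.norm_of_nonneg ht.1,
          Real.mul_rpow ht.1 (norm_nonneg _)]
      _ ≤ |M| * (t ^ ε * ‖v‖ ^ ε) * ‖v‖ ^ l := by
        have := ht.1
        gcongr
        exact le_abs_self M
      _ = _ := by
        rw [Real.rpow_add_of_nonneg (norm_nonneg _) (by positivity) hε.le, Real.rpow_natCast]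
        ring

section Sphere

variable {E : Type*} [NormedAddCommGroup E] [NormedSpace ℝ E] [MeasurableSpace E] [BorelSpace E]
  [FiniteDimensional ℝ E] (μ : Measure E) [μ.IsAddHaarMeasure]

open scoped Pointwise in
lemma measurePreserving_neg_toSphere :
    MeasurePreserving (fun ω : sphere (0 : E) 1 => -ω) μ.toSphere μ.toSphere := by
  have hm : Measurable (fun ω : sphere (0 : E) 1 => -ω) := continuous_neg.measurable
  refine ⟨hm, Measure.ext fun s hs => ?_⟩
  rw [Measure.map_apply hm hs, Measure.toSphere_apply' _ (hm hs), Measure.toSphere_apply' _ hs]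
  congr 1
  have : Ioo (0 : ℝ) 1 • ((↑) '' ((fun ω : sphere (0 : E) 1 => -ω) ⁻¹' s) : Set E) =
      -(Ioo (0 : ℝ) 1 • ((↑) '' s : Set E)) := by
    rw [← Set.smul_neg]
    congr 1
    ext y
    simp only [mem_image, mem_preimage, Set.mem_neg]
    constructor
    · rintro ⟨ω, h, rfl⟩
      exact ⟨-ω, h, by simp⟩
    · rintro ⟨ω, h, hy⟩
      exact ⟨-ω, by simpa, by simp [hy]⟩
  rw [this, Measure.measure_neg]

lemma integral_neg_toSphere {F : Type*} [NormedAddCommGroup F] [NormedSpace ℝ F]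
    (g : sphere (0 : E) 1 → F) :
    ∫ ω, g (-ω) ∂μ.toSphere = ∫ ω, g ω ∂μ.toSphere :=
  (measurePreserving_neg_toSphere μ).integral_comp
    (Homeomorph.neg (sphere (0 : E) 1)).measurableEmbedding g

lemma integral_eq_integral_toSphere [Nontrivial E] {F : Type*} [NormedAddCommGroup F]
    [NormedSpace ℝ F] {g : E → F} (hg : Integrable g μ) :
    ∫ y, g y ∂μ = ∫ r in Ioi (0 : ℝ), r ^ (Module.finrank ℝ E - 1) •
      ∫ ω : sphere (0 : E) 1, g (r • (ω : E)) ∂μ.toSphere := by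
  have hmp := μ.measurePreserving_homeomorphUnitSphereProd
  have hemb := (homeomorphUnitSphereProd E).measurableEmbedding
  set G : sphere (0 : E) 1 × Ioi (0 : ℝ) → F := fun p => g ((p.2 : ℝ) • (p.1 : E)) with hG
  have hGc : ∀ y : ({0}ᶜ : Set E), G (homeomorphUnitSphereProd E y) = g y := by
    intro y
    have hy : ‖(y : E)‖ ≠ 0 := norm_ne_zero_iff.2 y.2
    simp [hG, smul_smul, hy]
  have hGi : Integrable G (μ.toSphere.prod (Measure.volumeIoiPow (Module.finrank ℝ E - 1))) := by
    rw [← hmp.integrable_comp_emb hemb]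
    have : G ∘ homeomorphUnitSphereProd E = g ∘ (↑) := funext hGc
    rw [this, ← integrableOn_iff_comap_subtypeVal (measurableSet_singleton _).compl]
    exact hg.integrableOn
  calc ∫ y, g y ∂μ = ∫ y : ({0}ᶜ : Set E), g y ∂(μ.comap (↑)) := by
        rw [integral_subtype_comap (measurableSet_singleton _).compl g,
          restrict_compl_singleton]
    _ = ∫ p, G p ∂(μ.toSphere.prod (Measure.volumeIoiPow (Module.finrank ℝ E - 1))) := by
        rw [← hmp.integral_comp hemb]
        simp_rw [hGc]
    _ = ∫ r : Ioi (0 : ℝ), (∫ ω : sphere (0 : E) 1, g ((r : ℝ) • (ω : E)) ∂μ.toSphere)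
          ∂(Measure.volumeIoiPow (Module.finrank ℝ E - 1)) := integral_prod_symm G hGi
    _ = _ := by
      simp only [Measure.volumeIoiPow, ENNReal.ofReal]
      rw [integral_withDensity_eq_integral_smul,
        integral_subtype_comap measurableSet_Ioi fun r : ℝ =>
          Real.toNNReal (r ^ (Module.finrank ℝ E - 1)) •
            ∫ ω : sphere (0 : E) 1, g (r • (ω : E)) ∂μ.toSphere,
        setIntegral_congr_fun measurableSet_Ioi fun x hx ↦ ?_]
      · rw [NNReal.smul_def, Real.coe_toNNReal _ (pow_nonneg hx.out.le _)]
      · exact (measurable_subtype_coe.pow_const _).real_toNNReal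

end Sphere

lemma exists_differentiableOn_eq_add_mul_Gamma (m : ℕ) :
    ∃ (g : ℂ → ℂ) (U : Set ℂ), IsOpen U ∧ -(m : ℂ) ∈ U ∧ DifferentiableOn ℂ g U ∧
      ∀ s ∈ U, s ≠ -(m : ℂ) → g s = (s + m) * Gamma s := by
  induction m with
  | zero =>
    refine ⟨fun s => Gamma (s + 1), {s | -1 < s.re}, isOpen_lt continuous_const continuous_re,
      by simp, fun s hs => ?_, fun s _ h0 => ?_⟩
    · refine DifferentiableAt.differentiableWithinAt ?_
      refine DifferentiableAt.comp s (differentiableAt_Gamma (s + 1) fun k h => ?_) (by fun_prop)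
      have := congrArg re h
      have h1 : -1 < s.re := hs
      simp only [add_re, one_re, neg_re, natCast_re] at this
      have : (0 : ℝ) ≤ k := k.cast_nonneg
      linarith
    · simp only [CharP.cast_eq_zero, neg_zero] at h0
      simp [Gamma_add_one s h0]
  | succ m ih =>
    obtain ⟨g, U, hU, hmU, hg, hgs⟩ := ih
    refine ⟨fun s => g (s + 1) / s, (fun s => s + 1) ⁻¹' U ∩ {0}ᶜ,
      (hU.preimage (by fun_prop)).inter isOpen_compl_singleton, ?_, ?_, ?_⟩
    · refine ⟨by simpa using hmU, ?_⟩
      simp only [mem_compl_iff, mem_singleton_iff, neg_eq_zero]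
      exact_mod_cast m.succ_ne_zero
    · refine DifferentiableOn.div (hg.comp (by fun_prop) fun s hs => hs.1) (by fun_prop)
        fun s hs => hs.2
    · rintro s ⟨hs, h0⟩ hne
      have h0' : s ≠ 0 := h0
      simp only
      rw [hgs _ hs (fun h => hne (by push_cast; linear_combination h)), Gamma_add_one s h0']
      field_simp
      push_cast
      ring

lemma differentiable_inv_Gamma_half : Differentiable ℂ fun α : ℂ => (Gamma (α / 2))⁻¹ :=
  differentiable_one_div_Gamma.comp (by fun_prop : Differentiable ℂ fun α : ℂ => α / 2)

lemma inv_Gamma_half_mul_inv {α : ℂ} {j : ℕ} (hj : Even j) (hα : α ≠ -(j : ℂ)) :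
    (Gamma (α / 2))⁻¹ * (1 / (α + j)) = dslope (fun β : ℂ => (Gamma (β / 2))⁻¹) (-(j : ℂ)) α := by
  obtain ⟨k, rfl⟩ := hj
  have : Gamma (-((k + k : ℕ) : ℂ) / 2) = 0 := by
    rw [← Gamma_neg_nat_eq_zero k]
    congr 1
    push_cast
    ring
  rw [dslope_of_ne _ hα, slope_def_field, this]
  simp only [inv_zero, sub_zero, sub_neg_eq_add, one_mul, div_eq_mul_inv]

lemma differentiable_dslope_inv_Gamma_half (c : ℂ) :
    Differentiable ℂ (dslope (fun β : ℂ => (Gamma (β / 2))⁻¹) c) := by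
  rw [← differentiableOn_univ, Complex.differentiableOn_dslope univ_mem]
  exact differentiable_inv_Gamma_half.differentiableOn

lemma HasMellin.fun_sum {ι : Type*} (s : Finset ι) {f : ι → ℝ → ℂ} {m : ι → ℂ} {α : ℂ}
    (h : ∀ i ∈ s, HasMellin (f i) α (m i)) :
    HasMellin (fun t => ∑ i ∈ s, f i t) α (∑ i ∈ s, m i) := by
  refine ⟨?_, ?_⟩
  · simp only [MellinConvergent, Finset.smul_sum]
    exact integrable_finsetSum _ fun i hi => (h i hi).1
  · simp only [mellin, Finset.smul_sum]
    rw [integral_finsetSum _ fun i hi => (h i hi).1]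
    exact Finset.sum_congr rfl fun i hi => (h i hi).2

lemma exists_norm_comp_add_le {E F : Type*} [NormedAddCommGroup E] [ProperSpace E]
    [NormedAddCommGroup F] {f : E → F} {a : ℝ} (ha : 0 ≤ a)
    (hfc : Continuous f) (hdecay : f =O[cocompact E] fun y => ‖y‖ ^ (-a)) (x : E) :
    ∃ C : ℝ, ∀ z : E, ‖f (x + z)‖ ≤ C * (1 + ‖z‖) ^ (-a) := by
  obtain ⟨C₀, hC₀, hb⟩ := hdecay.exists_nonneg
  rw [isBigOWith_iff, ← Metric.cobounded_eq_cocompact] at hb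
  obtain ⟨R, -, hR⟩ := (hasBasis_cobounded_norm (E := E)).eventually_iff.1 hb
  obtain ⟨C₁, hC₁⟩ := (isCompact_closedBall (0 : E) (max R 1)).exists_bound_of_continuousOn
    hfc.continuousOn
  refine ⟨max C₁ 0 * (1 + ‖x‖ + max R 1) ^ a + C₀ * (2 + ‖x‖) ^ a, fun z => ?_⟩
  have hz : 0 < 1 + ‖z‖ := by positivity
  have htri : ‖z‖ ≤ ‖x + z‖ + ‖x‖ := by
    simpa [add_comm] using norm_sub_le (x + z) x
  rw [Real.rpow_neg hz.le, ← div_eq_mul_inv, le_div_iff₀ (by positivity)]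
  rcases le_total ‖x + z‖ (max R 1) with h | h
  · have h1 : ‖f (x + z)‖ ≤ max C₁ 0 := (hC₁ _ (by simpa using h)).trans (le_max_left _ _)
    calc ‖f (x + z)‖ * (1 + ‖z‖) ^ a ≤ max C₁ 0 * (1 + ‖x‖ + max R 1) ^ a := by
          gcongr ?_ * ?_ ^ a
          linarith
      _ ≤ _ := le_add_of_nonneg_right (by positivity)
  · have h1 : 1 ≤ ‖x + z‖ := (le_max_right _ _).trans h
    have h2 : ‖f (x + z)‖ ≤ C₀ * ‖x + z‖ ^ (-a) := by
      simpa [abs_of_nonneg (Real.rpow_nonneg (norm_nonneg _) _)] using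
        hR (x := x + z) ((le_max_left _ _).trans h)
    calc ‖f (x + z)‖ * (1 + ‖z‖) ^ a
        ≤ C₀ * ‖x + z‖ ^ (-a) * ((2 + ‖x‖) * ‖x + z‖) ^ a := by
          gcongr ?_ * ?_ ^ a
          nlinarith [norm_nonneg x]
      _ = C₀ * (2 + ‖x‖) ^ a := by
        have : 0 < ‖x + z‖ := by linarith
        rw [Real.mul_rpow (by positivity) (by positivity), Real.rpow_neg this.le]
        have := (Real.rpow_pos_of_pos this a).ne'
        field_simp
      _ ≤ _ := le_add_of_nonneg_left (by positivity)

lemma isBigO_one_add_rpow_neg {a : ℝ} (ha : 0 ≤ a) :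
    (fun r : ℝ => (1 + r) ^ (-a)) =O[atTop] fun r => r ^ (-a) := by
  refine IsBigO.of_bound 1 ?_
  filter_upwards [eventually_gt_atTop 0] with r hr
  rw [Real.norm_of_nonneg (by positivity), Real.norm_of_nonneg (by positivity), one_mul]
  exact Real.rpow_le_rpow_of_nonpos hr (by linarith) (by linarith)

lemma mellinConvergent_one_add_rpow_neg {a : ℝ} {s : ℂ} (h0 : 0 < s.re)
    (ha : s.re < a) : MellinConvergent (fun r : ℝ => (((1 + r) ^ (-a) : ℝ) : ℂ)) s := by
  have hc : ContinuousOn (fun r : ℝ => (((1 + r) ^ (-a) : ℝ) : ℂ)) (Ici 0) := by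
    refine continuous_ofReal.comp_continuousOn (ContinuousOn.rpow_const (by fun_prop) ?_)
    intro r hr
    have : (0 : ℝ) ≤ r := hr
    left
    positivity
  refine mellinConvergent_of_isBigO_rpow (a := a) (b := 0)
    ((hc.mono Ioi_subset_Ici_self).locallyIntegrableOn measurableSet_Ioi) ?_ ha ?_ h0
  · rw [← isBigO_norm_left]
    simpa only [norm_real, isBigO_norm_left] using isBigO_one_add_rpow_neg (h0.trans ha).le
  · simp only [neg_zero, Real.rpow_zero]
    have : Tendsto (fun r : ℝ => (((1 + r) ^ (-a) : ℝ) : ℂ)) (𝓝[>] 0) _ :=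
      (hc 0 (by simp)).tendsto.mono_left (nhdsWithin_mono _ Ioi_subset_Ici_self)
    exact this.isBigO_one ℝ

section SphericalIntegral

variable {E : Type*} [NormedAddCommGroup E] [NormedSpace ℝ E] [MeasurableSpace E] [BorelSpace E]
  [FiniteDimensional ℝ E] (μ : Measure E) [μ.IsAddHaarMeasure]

/-- The integral of `f` over the sphere of radius `r` centred at `x`, with respect to the pushforward
of the surface measure of the unit sphere. -/
noncomputable def sphericalIntegral (f : E → ℂ) (x : E) (r : ℝ) : ℂ :=
  ∫ ω : sphere (0 : E) 1, f (x + r • (ω : E)) ∂μ.toSphere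

lemma continuous_sphericalIntegral {f : E → ℂ} (hf : Continuous f) (x : E) :
    Continuous (sphericalIntegral μ f x) := by
  have := continuous_parametric_integral_of_continuous (μ := μ.toSphere) (s := univ)
    (f := fun (r : ℝ) (ω : sphere (0 : E) 1) => f (x + r • (ω : E)))
    (by simp only [Function.uncurry_def]; fun_prop) isCompact_univ
  simpa only [Measure.restrict_univ] using! this

lemma isBigO_sphericalIntegral {f : E → ℂ} {a : ℝ} (ha : 0 ≤ a)
    (hfc : Continuous f) (hdecay : f =O[cocompact E] fun y => ‖y‖ ^ (-a)) (x : E) :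
    sphericalIntegral μ f x =O[atTop] fun r => r ^ (-a) := by
  have := FiniteDimensional.proper_real E
  obtain ⟨C, hC⟩ := exists_norm_comp_add_le ha hfc hdecay x
  refine IsBigO.trans (IsBigO.of_bound (C * μ.toSphere.real univ) ?_) (isBigO_one_add_rpow_neg ha)
  filter_upwards [eventually_gt_atTop 0] with r hr
  rw [Real.norm_of_nonneg (by positivity)]
  refine (norm_integral_le_of_norm_le_const (C := C * (1 + r) ^ (-a))
    (Eventually.of_forall fun ω => ?_)).trans_eq (by ring)
  simpa [norm_smul, abs_of_pos hr] using hC (r • (ω : E))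

lemma exists_sphericalIntegral_expansion {f : E → ℂ} (hfc : Continuous f) {O : Set E}
    (hO : IsOpen O) {x : E} (hx : x ∈ O) {l : ℕ} (hf : ContDiffOn ℝ l f O) {M ε : ℝ} (hε : 0 < ε)
    (hM : ∀ x₁ ∈ O, ∀ x₂ ∈ O,
      ‖iteratedFDerivWithin ℝ l f O x₁ - iteratedFDerivWithin ℝ l f O x₂‖ ≤ M * ‖x₁ - x₂‖ ^ ε) :
    ∃ c : ℕ → ℂ, (∀ j, Odd j → c j = 0) ∧
      (fun r : ℝ => sphericalIntegral μ f x r - ∑ j ∈ Finset.range (l + 1), c j * (r : ℂ) ^ j)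
        =O[𝓝[>] 0] fun r => r ^ ((l : ℝ) + ε) := by
  obtain ⟨δ, hδ, hbound⟩ := exists_norm_sub_taylor_le hO hx hf hε hM
  set p : ℕ → E → ℂ := fun j v => iteratedFDerivWithin ℝ j f O x (fun _ => v) with hp
  have hpsmul : ∀ j (r : ℝ) v, p j (r • v) = (r : ℂ) ^ j * p j v := by
    intro j r v
    simp only [hp]
    rw [ContinuousMultilinearMap.map_smul_univ _ (fun _ => r) (fun _ => v)]
    simp
  have hpc : ∀ j, Continuous (p j) := fun j =>
    (iteratedFDerivWithin ℝ j f O x).cont.comp (continuous_pi fun _ => continuous_id)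
  have hint : ∀ {g : E → ℂ}, Continuous g →
      Integrable (fun ω : sphere (0 : E) 1 => g ω) μ.toSphere := fun hg =>
    (hg.comp continuous_subtype_val).integrable_of_hasCompactSupport
      (HasCompactSupport.of_compactSpace _)
  refine ⟨fun j => (1 / (j.factorial : ℝ)) • ∫ ω : sphere (0 : E) 1, p j ω ∂μ.toSphere, ?_, ?_⟩
  · intro j hj
    have h1 := integral_neg_toSphere μ (fun ω : sphere (0 : E) 1 => p j ω)
    have h2 : ∀ ω : sphere (0 : E) 1, p j ((-ω : sphere (0 : E) 1) : E) = -p j ω := by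
      intro ω
      have := hpsmul j (-1) ω
      simpa [hj.neg_one_pow] using this
    simp only [h2, integral_neg] at h1
    simp only [self_eq_neg.1 h1.symm, smul_zero]
  · refine IsBigO.of_bound (|M| * μ.toSphere.real univ) ?_
    filter_upwards [Ioo_mem_nhdsGT hδ] with r hr
    have hr0 : 0 < r := hr.1
    have heq : sphericalIntegral μ f x r - ∑ j ∈ Finset.range (l + 1),
        ((1 / (j.factorial : ℝ)) • ∫ ω : sphere (0 : E) 1, p j ω ∂μ.toSphere) * (r : ℂ) ^ j =
        ∫ ω : sphere (0 : E) 1, (f (x + r • (ω : E)) - ∑ j ∈ Finset.range (l + 1),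
          (1 / (j.factorial : ℝ)) • p j (r • (ω : E))) ∂μ.toSphere := by
      rw [integral_sub (hint (g := fun v => f (x + r • v)) (by fun_prop))
        (hint (g := fun v => ∑ j ∈ Finset.range (l + 1), (1 / (j.factorial : ℝ)) • p j (r • v))
          (by fun_prop)),
        integral_finsetSum _ fun j _ =>
          hint (g := fun v => (1 / (j.factorial : ℝ)) • p j (r • v)) (by fun_prop)]
      congr 1
      refine Finset.sum_congr rfl fun j _ => ?_
      simp only [hpsmul]
      rw [integral_smul, integral_const_mul, smul_mul_assoc, mul_comm]
    rw [heq, Real.norm_of_nonneg (by positivity)]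
    refine (norm_integral_le_of_norm_le_const (C := |M| * r ^ ((l : ℝ) + ε))
      (Eventually.of_forall fun ω => ?_)).trans_eq (by ring)
    have hn : ‖r • (ω : E)‖ = r := by simp [norm_smul, abs_of_pos hr0]
    have := hbound (r • (ω : E)) (by rw [hn]; exact hr.2)
    rwa [hn] at this

lemma integral_mul_norm_cpow_eq_mellin [Nontrivial E] {f : E → ℂ} {a : ℝ}
    (hfc : Continuous f) (hdecay : f =O[cocompact E] fun y => ‖y‖ ^ (-a)) (x : E) {α : ℂ}
    (h0 : 0 < α.re) (hα : α.re < a) :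
    ∫ y, f y * (‖x - y‖ : ℂ) ^ (α - Module.finrank ℝ E) ∂μ =
      mellin (sphericalIntegral μ f x) α := by
  have := FiniteDimensional.proper_real E
  set d := Module.finrank ℝ E with hd
  have hd0 : 0 < d := Module.finrank_pos
  have hcast : ((d - 1 : ℕ) : ℂ) = d - 1 := by
    rw [Nat.cast_sub hd0, Nat.cast_one]
  obtain ⟨C, hC⟩ := exists_norm_comp_add_le (h0.trans hα).le hfc hdecay x
  have hpow : ∀ r ∈ Ioi (0 : ℝ), ∀ w : ℂ,
      ((r ^ (d - 1) : ℝ) : ℂ) * (w * (r : ℂ) ^ (α - d)) = (r : ℂ) ^ (α - 1) * w := by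
    intro r hr w
    have hr' : (r : ℂ) ≠ 0 := ofReal_ne_zero.2 (ne_of_gt hr)
    rw [mul_left_comm, mul_comm w, ofReal_pow, ← cpow_natCast, ← cpow_add _ _ hr', hcast]
    congr 2
    ring
  have hmeas : AEStronglyMeasurable (fun z : E => f (x + z) * (‖z‖ : ℂ) ^ (α - d)) μ :=
    ((hfc.comp (by fun_prop)).measurable.mul (by fun_prop)).aestronglyMeasurable
  have hint : Integrable (fun z : E => f (x + z) * (‖z‖ : ℂ) ^ (α - d)) μ := by
    have h1 : Integrable
        (fun z : E => (((1 + ‖z‖) ^ (-a) : ℝ) : ℂ) * (‖z‖ : ℂ) ^ (α - d)) μ := by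
      rw [integrable_fun_norm_addHaar μ
        (f := fun r : ℝ => (((1 + r) ^ (-a) : ℝ) : ℂ) * (r : ℂ) ^ (α - d))]
      refine (mellinConvergent_one_add_rpow_neg h0 hα).congr_fun (fun r hr => ?_)
        measurableSet_Ioi
      simp only [real_smul, smul_eq_mul]
      exact (hpow r hr _).symm
    refine (h1.const_mul (C : ℂ)).mono hmeas (Eventually.of_forall fun z => ?_)
    rw [norm_mul, ← mul_assoc, norm_mul, ← ofReal_mul, norm_real]
    gcongr
    exact (hC z).trans (le_abs_self _)
  rw [← integral_add_left_eq_self _ x]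
  simp only [sub_add_cancel_left, norm_neg]
  rw [integral_eq_integral_toSphere μ hint, mellin]
  refine setIntegral_congr_fun measurableSet_Ioi fun r hr => ?_
  have hn : ∀ ω : sphere (0 : E) 1, ‖r • (ω : E)‖ = r := fun ω => by
    simp [norm_smul, abs_of_pos (mem_Ioi.1 hr)]
  simp only [hn, real_smul, smul_eq_mul, integral_mul_const]
  exact hpow r hr _

end SphericalIntegral

lemma exists_differentiableOn_eq_inv_Gamma_mul_mellin {A : ℝ → ℂ} (hA : Continuous A) {a b : ℝ}
    (htop : A =O[atTop] fun r => r ^ (-a)) {N : ℕ} {c : ℕ → ℂ} (hc : ∀ j, Odd j → c j = 0)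
    (hb : 0 ≤ b) (hbot : (fun r : ℝ => A r - ∑ j ∈ Finset.range N, c j * (r : ℂ) ^ j)
      =O[𝓝[>] 0] fun r => r ^ b) :
    ∃ L : ℂ → ℂ, DifferentiableOn ℂ L {α : ℂ | -b < α.re ∧ α.re < a} ∧
      ∀ α : ℂ, 0 < α.re → α.re < a → L α = (Gamma (α / 2))⁻¹ * mellin A α := by
  set T : ℝ → ℂ := fun r =>
    ∑ j ∈ Finset.range N, c j • indicator (Ioc 0 1) (fun t : ℝ => (t : ℂ) ^ (j : ℂ)) r with hT
  set B : ℝ → ℂ := fun r => A r - T r with hB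
  have hTloc : LocallyIntegrable T := by
    refine locallyIntegrable_finsetSum _ fun j _ => ?_
    have h : LocallyIntegrable
        (indicator (Ioc 0 1) (fun t : ℝ => (t : ℂ) ^ (j : ℂ))) := by
      simp only [cpow_natCast]
      exact LocallyIntegrable.indicator
        (Continuous.locallyIntegrable (by fun_prop)) measurableSet_Ioc
    exact h.smul (c j)
  have hBloc : LocallyIntegrableOn B (Ioi 0) :=
    (hA.locallyIntegrable.sub hTloc).locallyIntegrableOn _
  have hBtop : B =O[atTop] fun r => r ^ (-a) := by
    refine htop.congr' ?_ EventuallyEq.rfl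
    filter_upwards [eventually_gt_atTop 1] with r hr
    have : r ∉ Ioc (0 : ℝ) 1 := fun h => absurd h.2 (not_le.2 hr)
    simp [hB, hT, this]
  have hBbot : B =O[𝓝[>] 0] fun r => r ^ (-(-b)) := by
    rw [neg_neg]
    refine hbot.congr' ?_ EventuallyEq.rfl
    filter_upwards [Ioc_mem_nhdsGT one_pos] with r hr
    simp only [hB, hT, indicator_of_mem hr, cpow_natCast, smul_eq_mul]
  refine ⟨fun α => (Gamma (α / 2))⁻¹ * mellin B α + ∑ j ∈ Finset.range N,
    c j * dslope (fun β : ℂ => (Gamma (β / 2))⁻¹) (-(j : ℂ)) α, ?_, ?_⟩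
  · intro α hα
    refine DifferentiableAt.differentiableWithinAt ?_
    refine ((differentiable_inv_Gamma_half α).mul (mellin_differentiableAt_of_isBigO_rpow hBloc
      hBtop hα.2 hBbot hα.1)).add (DifferentiableAt.fun_sum fun j _ => ?_)
    exact (differentiable_dslope_inv_Gamma_half _ α).const_mul _
  · intro α h0 hα
    have hBconv : MellinConvergent B α :=
      mellinConvergent_of_isBigO_rpow hBloc hBtop hα hBbot (by linarith)
    have hTm : HasMellin T α (∑ j ∈ Finset.range N, c j * (1 / (α + j))) := by
      refine HasMellin.fun_sum _ fun j _ => ?_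
      have h1 := hasMellin_cpow_Ioc (j : ℂ) (s := α)
        (by simpa using add_pos_of_pos_of_nonneg h0 j.cast_nonneg)
      have h2 := hasMellin_const_smul h1.1 (c j)
      rwa [h1.2] at h2
    have hsum : mellin A α = mellin B α + mellin T α := by
      rw [← (hasMellin_add hBconv hTm.1).2]
      simp [hB]
    simp only [hsum, hTm.2, mul_add, Finset.mul_sum]
    congr 1
    refine Finset.sum_congr rfl fun j _ => ?_
    rcases j.even_or_odd with hj | hj
    · have hne : α ≠ -(j : ℂ) := by
        rintro rfl
        simp only [neg_re, natCast_re] at h0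
        have : (0 : ℝ) ≤ j := j.cast_nonneg
        linarith
      rw [← inv_Gamma_half_mul_inv hj hne]
      ring
    · simp [hc j hj]

theorem stmt_4 (a : ℝ) (ha : 0 < a) (l : ℕ) (ε : ℝ) (hε0 : 0 < ε) (hε1 : ε < 1) (n : ℕ)
    (hn : 0 < n) (x : EuclideanSpace ℝ (Fin n))
    (f : EuclideanSpace ℝ (Fin n) → ℂ) (hfc : Continuous f)
    (hdecay : f =O[cocompact (EuclideanSpace ℝ (Fin n))] fun y => ‖y‖ ^ (-a))
    (O : Set (EuclideanSpace ℝ (Fin n))) (hO : IsOpen O) (hxO : x ∈ O)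
    (hCl : ContDiffOn ℝ l f O)
    (M : ℝ) (hHolder : ∀ x₁ ∈ O, ∀ x₂ ∈ O,
      ‖iteratedFDerivWithin ℝ l f O x₁ - iteratedFDerivWithin ℝ l f O x₂‖ ≤ M * ‖x₁ - x₂‖ ^ ε) :
    ∃ F : ℂ → ℂ,
      DifferentiableOn ℂ F ({α : ℂ | -(l : ℝ) - ε < α.re ∧ α.re < a} \ poleSet n) ∧
      (∀ α : ℂ, 0 < α.re → α.re < a → α ∉ poleSet n → F α = riesz n f α x) ∧
      (∀ m : ℕ, -(l : ℝ) - ε < (n : ℝ) + 2 * m → ((n : ℝ) + 2 * m) < a →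
        ∃ (G : ℂ → ℂ) (U : Set ℂ), IsOpen U ∧ ((n : ℂ) + 2 * m) ∈ U ∧
          DifferentiableOn ℂ G U ∧
          ∀ α ∈ U, α ≠ (n : ℂ) + 2 * m → G α = (α - ((n : ℂ) + 2 * m)) * F α) := by
  have : Nontrivial (EuclideanSpace ℝ (Fin n)) := by
    have : Nonempty (Fin n) := ⟨⟨0, hn⟩⟩
    infer_instance
  obtain ⟨c, hc, hexp⟩ :=
    exists_sphericalIntegral_expansion volume hfc hO hxO hCl hε0 hHolder
  obtain ⟨L, hL, hLeq⟩ := exists_differentiableOn_eq_inv_Gamma_mul_mellin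
    (continuous_sphericalIntegral volume hfc x)
    (isBigO_sphericalIntegral volume ha.le hfc hdecay x) hc (by positivity) hexp
  have hset : {α : ℂ | -(l : ℝ) - ε < α.re ∧ α.re < a} =
      {α : ℂ | -((l : ℝ) + ε) < α.re ∧ α.re < a} := by
    simp only [neg_add']
  have hopen : IsOpen {α : ℂ | -((l : ℝ) + ε) < α.re ∧ α.re < a} :=
    (isOpen_lt continuous_const continuous_re).inter (isOpen_lt continuous_re continuous_const)
  set P : ℂ → ℂ := fun α => ((2 : ℂ) ^ α * (Real.pi : ℂ) ^ ((n : ℂ) / 2))⁻¹ with hP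
  have hPd : Differentiable ℂ P := by
    have h2 : Differentiable ℂ fun α : ℂ => (2 : ℂ) ^ α := fun α =>
      differentiableAt_id.const_cpow (Or.inl two_ne_zero)
    refine (h2.mul_const _).inv fun α => mul_ne_zero ?_ ?_
    · simp [cpow_eq_zero_iff]
    · simp [cpow_eq_zero_iff, Real.pi_ne_zero]
  have hinv : ∀ α, (Hfun n α)⁻¹ = P α * (Gamma (α / 2))⁻¹ * Gamma (((n : ℂ) - α) / 2) := by
    intro α
    rw [Hfun, inv_div, div_eq_mul_inv, mul_inv _ (Gamma (α / 2)), mul_comm]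
  refine ⟨fun α => P α * Gamma (((n : ℂ) - α) / 2) * L α, ?_, ?_, ?_⟩
  · rw [hset]
    rintro α ⟨hα, hαp⟩
    refine DifferentiableAt.differentiableWithinAt ?_
    refine ((hPd α).mul ?_).mul ((hL α hα).differentiableAt (hopen.mem_nhds hα))
    refine DifferentiableAt.comp α (differentiableAt_Gamma _ fun m hm => hαp ⟨m, ?_⟩)
      (by fun_prop)
    linear_combination (-2) * hm
  · intro α h0 hα _
    have hint := integral_mul_norm_cpow_eq_mellin volume hfc hdecay x h0 hα
    rw [finrank_euclideanSpace_fin] at hint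
    simp only [riesz, hint, hinv, hLeq α h0 hα]
    ring
  · intro m hm1 hm2
    obtain ⟨g, U, hU, hmU, hg, hgs⟩ := exists_differentiableOn_eq_add_mul_Gamma m
    have hcont : Continuous fun α : ℂ => ((n : ℂ) - α) / 2 := by fun_prop
    refine ⟨fun α => P α * (-2 * g (((n : ℂ) - α) / 2)) * L α,
      (fun α => ((n : ℂ) - α) / 2) ⁻¹' U ∩ {α : ℂ | -((l : ℝ) + ε) < α.re ∧ α.re < a},
      (hU.preimage hcont).inter hopen, ⟨?_, ?_⟩, ?_, ?_⟩
    · rw [mem_preimage]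
      convert hmU using 1
      ring
    · have hre : ((n : ℂ) + 2 * m).re = n + 2 * m := by simp
      rw [mem_ofPred_eq, hre]
      exact ⟨by linarith, hm2⟩
    · refine (hPd.differentiableOn.mul (DifferentiableOn.const_mul ?_ _)).mul
        (hL.mono inter_subset_right)
      exact hg.comp (by fun_prop) fun α hα => hα.1
    · rintro α ⟨hαU, -⟩ hne
      simp only
      rw [hgs _ hαU fun h => hne (by linear_combination (-2) * h)]
      ring
end

section
/- Let a > 0, n ∈ ℕ and x ∈ ℝⁿ. Let f : ℝⁿ → ℂ be continuous with f(x) = O(|x|^{-a}), and assume that for every point of ℝⁿ there exist a neighborhood and an ε ∈ (0,1) on which f is Hölder continuous of index ε. Then there exist δ > 0 and a holomorphic function F on the strip {α ∈ ℂ : -δ < Re α < min(a, δ, n)} such that F(α) = (I^α f)(x) = (1/H_n(α)) ∫_{ℝⁿ} f(y)|x - y|^{α-n} dy whenever 0 < Re α < min(a, δ, n), and F(0) = f(x). (In the notation of the paper: (I^0 f)(x) = f(x) for f ∈ C_a^{0+}(ℝⁿ).) -/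
open Complex MeasureTheory Filter Asymptotics Set Metric

/-- On a neighbourhood of width `η` around `σ`, the derivative of `s ↦ t ^ s` is dominated by
the powers of `t` with exponents `σ ± 2η`. -/
lemma rpow_mul_abs_log_le {t η σ s : ℝ} (ht : 0 < t) (hη : 0 < η) (hs : |s - σ| ≤ η) :
    t ^ s * |Real.log t| ≤ η⁻¹ * (t ^ (σ - 2 * η) + t ^ (σ + 2 * η)) := by
  obtain ⟨h₁, h₂⟩ := abs_le.1 hs
  have key : ∀ e, |Real.log t| ≤ t ^ e / η → t ^ s * |Real.log t| ≤ η⁻¹ * t ^ (s + e) := by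
    intro e he
    calc t ^ s * |Real.log t| ≤ t ^ s * (t ^ e / η) := by gcongr
      _ = η⁻¹ * t ^ (s + e) := by rw [Real.rpow_add ht]; ring
  rcases le_total 1 t with h | h
  · have hlog : |Real.log t| ≤ t ^ η / η := by
      rw [abs_of_nonneg (Real.log_nonneg h)]
      exact Real.log_le_rpow_div ht.le hη
    refine (key η hlog).trans ?_
    gcongr
    have h₃ : t ^ (s + η) ≤ t ^ (σ + 2 * η) := Real.rpow_le_rpow_of_exponent_le h (by linarith)
    have h₄ := Real.rpow_pos_of_pos ht (σ - 2 * η)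
    linarith
  · have hlog : |Real.log t| ≤ t ^ (-η) / η := by
      rw [abs_of_nonpos (Real.log_nonpos ht.le h), ← Real.log_inv, Real.rpow_neg ht.le,
        ← Real.inv_rpow ht.le]
      exact Real.log_le_rpow_div (inv_nonneg.2 ht.le) hη
    refine (key (-η) hlog).trans ?_
    gcongr
    have h₃ : t ^ (s + -η) ≤ t ^ (σ - 2 * η) :=
      Real.rpow_le_rpow_of_exponent_ge ht h (by linarith)
    have h₄ := Real.rpow_pos_of_pos ht (σ + 2 * η)
    linarith

/-- A parametric integral of complex powers is holomorphic on every strip on which it converges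
absolutely. -/
lemma differentiableOn_integral_mul_cpow {Ω : Type*} [MeasurableSpace Ω] {μ : Measure Ω}
    {g : Ω → ℂ} {d : Ω → ℝ} (hg : AEStronglyMeasurable g μ) (hd : Measurable d)
    (hd0 : ∀ᵐ y ∂μ, 0 < d y) {A B : ℝ}
    (hint : ∀ s, A < s → s < B → Integrable (fun y => ‖g y‖ * d y ^ s) μ) :
    DifferentiableOn ℂ (fun β : ℂ => ∫ y, g y * (d y : ℂ) ^ β ∂μ) {β | A < β.re ∧ β.re < B} := by
  rintro β ⟨hA, hB⟩
  obtain ⟨η, hη, hηA, hηB⟩ : ∃ η > 0, A < β.re - 2 * η ∧ β.re + 2 * η < B := by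
    refine ⟨min (β.re - A) (B - β.re) / 3, by have := lt_min (sub_pos.2 hA) (sub_pos.2 hB); linarith,
      ?_, ?_⟩
    · have := min_le_left (β.re - A) (B - β.re); linarith
    · have := min_le_right (β.re - A) (B - β.re); linarith
  have hcpow : ∀ γ : ℂ, Measurable fun y => (d y : ℂ) ^ γ := fun γ => by fun_prop
  have hpow : ∀ γ : ℂ, AEStronglyMeasurable (fun y => g y * (d y : ℂ) ^ γ) μ := fun γ =>
    hg.mul (hcpow γ).aestronglyMeasurable
  have hbound := ((hint (β.re - 2 * η) hηA (by linarith)).add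
    (hint (β.re + 2 * η) (by linarith) hηB)).const_mul η⁻¹
  refine (hasDerivAt_integral_of_dominated_loc_of_deriv_le (𝕜 := ℂ) (μ := μ)
    (F := fun γ y => g y * (d y : ℂ) ^ γ)
    (F' := fun γ y => g y * ((d y : ℂ) ^ γ * Complex.log (d y))) (Metric.ball_mem_nhds β hη)
    (Eventually.of_forall hpow) ?_ 
    (hg.mul ((hcpow β).mul (by fun_prop : Measurable fun y =>
      Complex.log (d y : ℂ))).aestronglyMeasurable) ?_ hbound ?_).2
      |>.differentiableAt.differentiableWithinAt
  · refine ((hint β.re hA hB).congr' (hpow β) ?_)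
    filter_upwards [hd0] with y hy
    simp [norm_cpow_eq_rpow_re_of_pos hy, abs_of_pos (Real.rpow_pos_of_pos hy _)]
  · filter_upwards [hd0] with y hy γ hγ
    have hre : |γ.re - β.re| ≤ η := by
      rw [← sub_re]
      exact (abs_re_le_norm _).trans (mem_ball_iff_norm.1 hγ).le
    rw [norm_mul, norm_mul, norm_cpow_eq_rpow_re_of_pos hy, ← ofReal_log hy.le, norm_real,
      Real.norm_eq_abs]
    calc _ ≤ ‖g y‖ * (η⁻¹ * (d y ^ (β.re - 2 * η) + d y ^ (β.re + 2 * η))) := by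
          exact mul_le_mul_of_nonneg_left (rpow_mul_abs_log_le hy hη hre) (norm_nonneg _)
      _ = _ := by simp only [Pi.add_apply]; ring
  · filter_upwards [hd0] with y hy γ _
    have := (hasDerivAt_id γ).const_cpow (c := (d y : ℂ)) (Or.inl (by exact_mod_cast hy.ne'))
    simpa using this.const_mul (g y)

section Radial

variable {E : Type*} [NormedAddCommGroup E] [NormedSpace ℝ E] [FiniteDimensional ℝ E]
  [Nontrivial E] [MeasurableSpace E] [BorelSpace E] (μ : Measure E) [μ.IsAddHaarMeasure]

lemma integrable_indicator_Iio_norm_rpow {p : ℝ} (hp : -(Module.finrank ℝ E : ℝ) < p) (r : ℝ) :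
    Integrable (fun z : E => (Iio r).indicator (fun t : ℝ => t ^ p) ‖z‖) μ := by
  have hn : 1 ≤ Module.finrank ℝ E := Module.finrank_pos
  rw [integrable_fun_norm_addHaar μ (f := (Iio r).indicator (fun t : ℝ => t ^ p))]
  have h := intervalIntegral.intervalIntegrable_rpow' (a := 0) (b := r)
    (r := Module.finrank ℝ E - 1 + p) (by linarith)
  have h₁ := (h.1.mono_set Ioo_subset_Ioc_self).integrable_indicator measurableSet_Ioo
  refine h₁.integrableOn.congr_fun (fun t (ht : 0 < t) => ?_) measurableSet_Ioi
  by_cases htr : t < r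
  · rw [indicator_of_mem (show t ∈ Ioo 0 r from ⟨ht, htr⟩), indicator_of_mem (show t ∈ Iio r from htr),
      Real.rpow_add ht, smul_eq_mul, ← Real.rpow_natCast, Nat.cast_sub hn, Nat.cast_one]
  · rw [indicator_of_notMem (fun h : t ∈ Ioo 0 r => htr h.2),
      indicator_of_notMem (show t ∉ Iio r from htr), smul_zero]

lemma integrable_indicator_Ici_norm_rpow {p : ℝ} (hp : p < -(Module.finrank ℝ E : ℝ)) {r : ℝ}
    (hr : 0 < r) :
    Integrable (fun z : E => (Ici r).indicator (fun t : ℝ => t ^ p) ‖z‖) μ := by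
  have hn : 1 ≤ Module.finrank ℝ E := Module.finrank_pos
  rw [integrable_fun_norm_addHaar μ (f := (Ici r).indicator (fun t : ℝ => t ^ p))]
  have h := integrableOn_Ioi_rpow_of_lt (a := Module.finrank ℝ E - 1 + p) (by linarith) hr
  have h₁ := ((integrableOn_Ici_iff_integrableOn_Ioi (by simp)).2 h).integrable_indicator measurableSet_Ici
  refine h₁.integrableOn.congr_fun (fun t (ht : 0 < t) => ?_) measurableSet_Ioi
  by_cases htr : r ≤ t
  · rw [indicator_of_mem (show t ∈ Ici r from htr), indicator_of_mem (show t ∈ Ici r from htr),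
      Real.rpow_add ht, smul_eq_mul, ← Real.rpow_natCast, Nat.cast_sub hn, Nat.cast_one]
  · rw [indicator_of_notMem (show t ∉ Ici r from htr), indicator_of_notMem (show t ∉ Ici r from htr),
      smul_zero]

lemma integral_indicator_Iio_norm_cpow {α : ℂ} (hα : 0 < α.re) {r : ℝ} (hr : 0 < r) :
    ∫ z : E, (Iio r).indicator (fun t : ℝ => (t : ℂ) ^ (α - Module.finrank ℝ E)) ‖z‖ ∂μ =
      Module.finrank ℝ E * μ.real (ball 0 1) * ((r : ℂ) ^ α / α) := by
  have hn : 1 ≤ Module.finrank ℝ E := Module.finrank_pos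
  have hα0 : α ≠ 0 := by rintro rfl; simp at hα
  have hint : ∫ t : ℝ in (0 : ℝ)..r, (t : ℂ) ^ (α - 1) = (r : ℂ) ^ α / α := by
    rw [integral_cpow (Or.inl (by simpa using hα))]
    simp [hα0]
  rw [integral_fun_norm_addHaar μ
    ((Iio r).indicator (fun t : ℝ => (t : ℂ) ^ (α - Module.finrank ℝ E))), ← hint,
    intervalIntegral.integral_of_le hr.le, ← integral_Ioc_eq_integral_Ioo.symm,
    nsmul_eq_mul, real_smul, mul_assoc]
  congr 2
  rw [← Ioi_inter_Iio, ← setIntegral_indicator measurableSet_Iio]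
  refine setIntegral_congr_fun measurableSet_Ioi fun t (ht : 0 < t) => ?_
  by_cases htr : t ∈ Iio r
  · have ht0 : (t : ℂ) ≠ 0 := by exact_mod_cast ht.ne'
    simp only [indicator_of_mem htr]
    rw [real_smul, ofReal_pow, ← cpow_natCast, ← cpow_add _ _ ht0, Nat.cast_sub hn]
    congr 1
    push_cast
    ring
  · simp only [indicator_of_notMem htr, smul_zero]

end Radial

lemma exists_norm_le_mul_rpow_of_isBigO {E : Type*} [NormedAddCommGroup E] [ProperSpace E]
    {f : E → ℂ} (hf : Continuous f) {a : ℝ} (ha : 0 < a)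
    (hdecay : f =O[cocompact E] fun y => ‖y‖ ^ (-a)) (x : E) :
    ∃ C, 0 ≤ C ∧ ∀ y, y ≠ x → ‖f y‖ ≤ C * ‖x - y‖ ^ (-a) := by
  obtain ⟨c, hc, hbig⟩ := hdecay.exists_pos
  have hfar : ∀ᶠ y in cocompact E, ‖f y‖ * ‖x - y‖ ^ a ≤ c * 2 ^ a := by
    filter_upwards [hbig.bound, (tendsto_norm_cocompact_atTop (E := E)).eventually_ge_atTop ‖x‖,
      (tendsto_norm_cocompact_atTop (E := E)).eventually_gt_atTop 0] with y h₁ h₂ h₃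
    have h₄ : ‖x - y‖ ≤ 2 * ‖y‖ := (norm_sub_le _ _).trans (by linarith)
    rw [Real.norm_of_nonneg (by positivity)] at h₁
    calc ‖f y‖ * ‖x - y‖ ^ a ≤ (c * ‖y‖ ^ (-a)) * (2 * ‖y‖) ^ a := by gcongr
      _ = c * 2 ^ a * (‖y‖ ^ (-a) * ‖y‖ ^ a) := by
        rw [Real.mul_rpow zero_le_two h₃.le]; ring
      _ = c * 2 ^ a := by rw [← Real.rpow_add h₃]; simp
  obtain ⟨K, hK, hKc⟩ := mem_cocompact.1 hfar
  have hcont : Continuous fun y => ‖f y‖ * ‖x - y‖ ^ a := by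
    refine hf.norm.mul (Continuous.rpow_const (by fun_prop) fun _ => Or.inr ha.le)
  obtain ⟨D, hD⟩ := hK.exists_bound_of_continuousOn hcont.continuousOn
  refine ⟨max D (c * 2 ^ a), le_max_of_le_right (by positivity), fun y hy => ?_⟩
  have hpos : 0 < ‖x - y‖ := norm_pos_iff.2 (sub_ne_zero.2 hy.symm)
  rw [Real.rpow_neg hpos.le, ← div_eq_mul_inv, le_div_iff₀ (by positivity)]
  by_cases hyK : y ∈ K
  · exact ((le_abs_self _).trans (hD y hyK)).trans (le_max_left _ _)
  · exact (hKc hyK : _ ≤ _).trans (le_max_right _ _)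

/-- If `f` decays like `‖y‖ ^ (-a)` and is Hölder continuous of index `ε` at `x`, then `f` minus
`f x` times the indicator of a small ball around `x` is integrable against `‖x - y‖ ^ s`, for
`-ε < s + dim E < a`. -/
lemma exists_integrable_sub_indicator_mul_rpow {E : Type*} [NormedAddCommGroup E]
    [NormedSpace ℝ E] [FiniteDimensional ℝ E] [Nontrivial E] [MeasurableSpace E] [BorelSpace E]
    (μ : Measure E) [μ.IsAddHaarMeasure] {f : E → ℂ} (hf : Continuous f) {a ε M : ℝ} (ha : 0 < a)
    (hdecay : f =O[cocompact E] fun y => ‖y‖ ^ (-a)) {x : E} {U : Set E} (hU : U ∈ nhds x)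
    (hHolder : ∀ y ∈ U, ‖f y - f x‖ ≤ M * ‖y - x‖ ^ ε) :
    ∃ r, 0 < r ∧ ∀ s, -(Module.finrank ℝ E) - ε < s → s < a - Module.finrank ℝ E →
      Integrable (fun y => ‖f y - (ball x r).indicator (fun _ => f x) y‖ * ‖x - y‖ ^ s) μ := by
  have : ProperSpace E := FiniteDimensional.proper ℝ E
  obtain ⟨r, hr, hrU⟩ := Metric.mem_nhds_iff.1 hU
  obtain ⟨C, hC, hfC⟩ := exists_norm_le_mul_rpow_of_isBigO hf ha hdecay x
  refine ⟨r, hr, fun s hs₁ hs₂ => ?_⟩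
  have h₁ := ((integrable_indicator_Iio_norm_rpow μ (p := ε + s) (by linarith) r).comp_sub_left
    x).const_mul M
  have h₂ := ((integrable_indicator_Ici_norm_rpow μ (p := -a + s) (by linarith) hr).comp_sub_left
    x).const_mul C
  refine (h₁.add h₂).mono' ?_ ?_
  · exact ((hf.aestronglyMeasurable.sub
      (aestronglyMeasurable_const.indicator measurableSet_ball)).norm.mul
        (by fun_prop : Measurable fun y => ‖x - y‖ ^ s).aestronglyMeasurable)
  · have hne : ∀ᵐ y ∂μ, y ≠ x := by simp [ae_iff]
    filter_upwards [hne] with y hy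
    have hpos : 0 < ‖x - y‖ := norm_pos_iff.2 (sub_ne_zero.2 hy.symm)
    rw [Real.norm_of_nonneg (by positivity)]
    by_cases hyr : ‖x - y‖ < r
    · have hyb : y ∈ ball x r := by rwa [mem_ball, dist_comm, dist_eq_norm]
      have hle := hHolder y (hrU hyb)
      rw [norm_sub_rev y x] at hle
      simp only [Pi.add_apply]
      rw [indicator_of_mem hyb, indicator_of_mem (show ‖x - y‖ ∈ Iio r from hyr),
        indicator_of_notMem (show ‖x - y‖ ∉ Ici r from not_le.2 hyr), Real.rpow_add hpos, mul_zero,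
        add_zero, ← mul_assoc]
      gcongr
    · have hyb : y ∉ ball x r := by rwa [mem_ball, dist_comm, dist_eq_norm]
      have hle := hfC y hy
      simp only [Pi.add_apply]
      rw [indicator_of_notMem hyb, indicator_of_notMem (show ‖x - y‖ ∉ Iio r from hyr),
        indicator_of_mem (show ‖x - y‖ ∈ Ici r from not_lt.1 hyr), Real.rpow_add hpos, mul_zero,
        zero_add, ← mul_assoc, sub_zero]
      gcongr

/-- The part of `1 / H_n` that has neither zeros nor poles near the origin. -/
noncomputable def HfunRegularInv (n : ℕ) (α : ℂ) : ℂ :=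
  Complex.Gamma (((n : ℂ) - α) / 2) * ((2 : ℂ) ^ α * (Real.pi : ℂ) ^ ((n : ℂ) / 2))⁻¹

lemma inv_Hfun (n : ℕ) (α : ℂ) :
    (Hfun n α)⁻¹ = HfunRegularInv n α * (Complex.Gamma (α / 2))⁻¹ := by
  simp only [Hfun, HfunRegularInv, div_eq_mul_inv, mul_inv, inv_inv]
  ring

lemma differentiableAt_HfunRegularInv {n : ℕ} {α : ℂ} (hα : α.re < n) :
    DifferentiableAt ℂ (HfunRegularInv n) α := by
  have hre : 0 < (((n : ℂ) - α) / 2).re := by simpa using hα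
  have hΓ : DifferentiableAt ℂ (fun α : ℂ => Complex.Gamma (((n : ℂ) - α) / 2)) α :=
    DifferentiableAt.comp (g := Complex.Gamma) α (differentiableAt_Gamma _ fun m h => by
      rw [h] at hre
      simp only [neg_re, natCast_re, Left.neg_pos_iff] at hre
      exact hre.not_ge m.cast_nonneg) (by fun_prop)
  have hpi : (Real.pi : ℂ) ^ ((n : ℂ) / 2) ≠ 0 := by
    simp [cpow_eq_zero_iff, Real.pi_ne_zero]
  refine hΓ.mul (DifferentiableAt.inv (DifferentiableAt.mul_const ?_ _)
    (mul_ne_zero (by simp [cpow_eq_zero_iff]) hpi))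
  exact differentiableAt_id.const_cpow (Or.inl two_ne_zero)

lemma differentiable_inv_Gamma_comp_half :
    Differentiable ℂ fun α : ℂ => (Complex.Gamma (α / 2))⁻¹ :=
  differentiable_one_div_Gamma.comp (by fun_prop)

lemma HfunRegularInv_zero_mul_volume (n : ℕ) (hn : 0 < n) :
    HfunRegularInv n 0 *
      ((n : ℂ) / 2 * volume.real (ball (0 : EuclideanSpace ℝ (Fin n)) 1)) = 1 := by
  have : Nonempty (Fin n) := Fin.pos_iff_nonempty.1 hn
  have hn0 : (n : ℂ) / 2 ≠ 0 := by simp [hn.ne']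
  have hΓ : 0 < Real.Gamma ((n : ℝ) / 2 + 1) := Real.Gamma_pos_of_pos (by positivity)
  have hpi : (Real.pi : ℂ) ^ ((n : ℂ) / 2) ≠ 0 := by
    simp [cpow_eq_zero_iff, Real.pi_ne_zero]
  have hsqrt : ((√Real.pi ^ n : ℝ) : ℂ) = (Real.pi : ℂ) ^ ((n : ℂ) / 2) := by
    rw [Real.sqrt_eq_rpow, ← Real.rpow_natCast, ← Real.rpow_mul Real.pi_pos.le,
      ofReal_cpow Real.pi_pos.le]
    push_cast
    ring_nf
  have hΓ2 : Complex.Gamma ((n : ℂ) / 2 + 1) ≠ 0 := by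
    have h : ((Real.Gamma ((n : ℝ) / 2 + 1) : ℝ) : ℂ) ≠ 0 := by exact_mod_cast hΓ.ne'
    simpa [← Complex.Gamma_ofReal] using h
  rw [Measure.real, EuclideanSpace.volume_ball, Fintype.card_fin, ENNReal.ofReal_one, one_pow,
    one_mul, ENNReal.toReal_ofReal (by positivity), ofReal_div, hsqrt, ← Complex.Gamma_ofReal]
  simp only [HfunRegularInv, sub_zero, cpow_zero, one_mul]
  push_cast
  have hrec := Complex.Gamma_add_one _ hn0
  rw [hrec] at hΓ2 ⊢
  have hΓ3 := right_ne_zero_of_mul hΓ2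
  have hn1 : (n : ℂ) ≠ 0 := by exact_mod_cast hn.ne'
  field_simp

theorem stmt_5 (a : ℝ) (ha : 0 < a) (n : ℕ) (hn : 0 < n) (x : EuclideanSpace ℝ (Fin n))
    (f : EuclideanSpace ℝ (Fin n) → ℂ) (hfc : Continuous f)
    (hdecay : f =O[cocompact (EuclideanSpace ℝ (Fin n))] fun y => ‖y‖ ^ (-a))
    (hHolder : ∀ z : EuclideanSpace ℝ (Fin n),
      ∃ (U : Set (EuclideanSpace ℝ (Fin n))) (ε : ℝ) (M : ℝ), IsOpen U ∧ z ∈ U ∧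
        0 < ε ∧ ε < 1 ∧
        ∀ x₁ ∈ U, ∀ x₂ ∈ U, ‖f x₁ - f x₂‖ ≤ M * ‖x₁ - x₂‖ ^ ε) :
    ∃ δ : ℝ, 0 < δ ∧
      ∃ F : ℂ → ℂ,
        DifferentiableOn ℂ F {α : ℂ | -δ < α.re ∧ α.re < min a (min δ n)} ∧
        (∀ α : ℂ, 0 < α.re → α.re < min a (min δ n) → F α = riesz n f α x) ∧
        F 0 = f x := by
  have : Nonempty (Fin n) := Fin.pos_iff_nonempty.1 hn
  obtain ⟨U, ε, M, hUo, hxU, hε, hε1, hM⟩ := hHolder x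
  obtain ⟨r, hr, hint⟩ := exists_integrable_sub_indicator_mul_rpow volume hfc ha hdecay
    (hUo.mem_nhds hxU) (fun y hy => hM y hy x hxU)
  rw [finrank_euclideanSpace_fin] at hint
  set g : EuclideanSpace ℝ (Fin n) → ℂ := fun y =>
    f y - (ball x r).indicator (fun _ => f x) y with hg
  replace hint : ∀ s, -(n : ℝ) - ε < s → s < a - n →
      Integrable fun y => ‖g y‖ * ‖x - y‖ ^ s := hint
  have hgm : AEStronglyMeasurable g volume := hfc.aestronglyMeasurable.sub
    (aestronglyMeasurable_const.indicator measurableSet_ball)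
  have hdm : Measurable fun y : EuclideanSpace ℝ (Fin n) => ‖x - y‖ := by fun_prop
  have hd0 : ∀ᵐ y : EuclideanSpace ℝ (Fin n), 0 < ‖x - y‖ := by
    have hne : ∀ᵐ y : EuclideanSpace ℝ (Fin n), y ≠ x := by simp [ae_iff]
    filter_upwards [hne] with y hy
    exact norm_pos_iff.2 (sub_ne_zero.2 hy.symm)
  have hhol := differentiableOn_integral_mul_cpow hgm hdm hd0 hint
  set G : ℂ → ℂ := fun β => ∫ y, g y * ((‖x - y‖ : ℝ) : ℂ) ^ β with hG
  set v : ℝ := volume.real (ball (0 : EuclideanSpace ℝ (Fin n)) 1) with hv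
  have hr0 : (r : ℂ) ≠ 0 := by exact_mod_cast hr.ne'
  refine ⟨ε, hε, fun α => HfunRegularInv n α * ((Complex.Gamma (α / 2))⁻¹ * G (α - n) +
    f x * ((n : ℂ) / 2 * v * ((r : ℂ) ^ α * (Complex.Gamma (α / 2 + 1))⁻¹))), ?_, ?_, ?_⟩
  · rintro α ⟨h₁, h₂⟩
    obtain ⟨ha', -, hn'⟩ : α.re < a ∧ α.re < ε ∧ α.re < n := by simpa using h₂
    refine (differentiableAt_HfunRegularInv hn').differentiableWithinAt.mul
      (((differentiable_inv_Gamma_comp_half α).differentiableWithinAt.mul ?_).add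
        (DifferentiableAt.differentiableWithinAt ?_))
    · refine (hhol.comp (t := {β : ℂ | -(n : ℝ) - ε < β.re ∧ β.re < a - n})
        (s := {α : ℂ | -ε < α.re ∧ α.re < min a (min ε n)}) (f := fun α : ℂ => α - n)
        (by fun_prop) ?_) α ⟨h₁, h₂⟩
      rintro γ ⟨h₃, h₄⟩
      have h₅ := lt_of_lt_of_le h₄ (min_le_left _ _)
      constructor <;> simp only [sub_re, natCast_re] <;> linarith
    · refine DifferentiableAt.const_mul (DifferentiableAt.const_mul
        ((differentiableAt_id.const_cpow (Or.inl hr0)).mul ?_) _) _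
      exact (differentiable_one_div_Gamma.comp
        (by fun_prop : Differentiable ℂ fun α : ℂ => α / 2 + 1)) α
  · intro α hα h₂
    obtain ⟨ha', -, hn'⟩ : α.re < a ∧ α.re < ε ∧ α.re < n := by simpa using h₂
    have hα0 : α ≠ 0 := by rintro rfl; simp at hα
    have hpolar := integral_indicator_Iio_norm_cpow
      (volume : Measure (EuclideanSpace ℝ (Fin n))) hα hr
    rw [finrank_euclideanSpace_fin] at hpolar
    have hball := (integral_sub_left_eq_self (fun z : EuclideanSpace ℝ (Fin n) =>
      (Iio r).indicator (fun t : ℝ => (t : ℂ) ^ (α - n)) ‖z‖) volume x).trans hpolar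
    have hballint : Integrable (fun y : EuclideanSpace ℝ (Fin n) =>
        (Iio r).indicator (fun t : ℝ => (t : ℂ) ^ (α - n)) ‖x - y‖) := by
      have h := (integrable_indicator_Iio_norm_rpow
        (volume : Measure (EuclideanSpace ℝ (Fin n))) (p := α.re - n) (by simpa using hα)
        r).comp_sub_left x
      refine h.congr' ?_ ?_
      · exact (((by fun_prop : Measurable fun t : ℝ => (t : ℂ) ^ (α - n)).indicator
          measurableSet_Iio).comp hdm).aestronglyMeasurable
      · filter_upwards [hd0] with y hy
        rw [norm_indicator_eq_indicator_norm, norm_indicator_eq_indicator_norm]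
        simp only [indicator]
        split_ifs
        · rw [norm_cpow_eq_rpow_re_of_pos hy, Real.norm_of_nonneg (by positivity)]
          simp
        · rfl
    have hgint : Integrable fun y => g y * ((‖x - y‖ : ℝ) : ℂ) ^ (α - n) := by
      refine (hint (α.re - n) (by linarith) (by linarith)).congr' (hgm.mul
        (by fun_prop : Measurable fun y =>
          ((‖x - y‖ : ℝ) : ℂ) ^ (α - n)).aestronglyMeasurable) ?_
      filter_upwards [hd0] with y hy
      rw [norm_mul, norm_mul, norm_norm, norm_cpow_eq_rpow_re_of_pos hy,
        Real.norm_of_nonneg (by positivity)]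
      simp
    have hsplit : ∫ y, f y * ((‖x - y‖ : ℝ) : ℂ) ^ (α - n) =
        G (α - n) + f x * (n * v * ((r : ℂ) ^ α / α)) := by
      rw [← hball, hG, ← integral_const_mul, ← integral_add hgint (hballint.const_mul _)]
      refine integral_congr_ae (Eventually.of_forall fun y => ?_)
      by_cases hy : y ∈ ball x r
      · have hy' : ‖x - y‖ ∈ Iio r := by rwa [mem_ball, dist_comm, dist_eq_norm] at hy
        simp only [hg, indicator_of_mem hy, indicator_of_mem hy']
        ring
      · have hy' : ‖x - y‖ ∉ Iio r := by rwa [mem_ball, dist_comm, dist_eq_norm] at hy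
        simp only [hg, indicator_of_notMem hy, indicator_of_notMem hy']
        ring
    have hΓ : (Complex.Gamma (α / 2 + 1))⁻¹ = 2 / α * (Complex.Gamma (α / 2))⁻¹ := by
      rw [Complex.Gamma_add_one _ (div_ne_zero hα0 two_ne_zero), mul_inv, inv_div]
    rw [riesz, hsplit, inv_Hfun]
    simp only [hΓ]
    ring
  · have h := HfunRegularInv_zero_mul_volume n hn
    simp only [← hv] at h
    simp only [zero_div, Complex.Gamma_zero, inv_zero, zero_mul, zero_add, cpow_zero,
      Complex.Gamma_one, inv_one, mul_one]
    rw [mul_left_comm, h, mul_one]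
end

section
/- Let a > 0, n ∈ ℕ, and let f : ℝⁿ → ℂ be continuous with f(x) = O(|x|^{-a}). Let α ∈ ℂ with 0 < Re α < min(a, n), and let b satisfy Re α < b ≤ min(a, n) in case a ≠ n, or Re α < b < n in case a = n. Then I^α f is continuous on ℝⁿ and (I^α f)(x) = O(|x|^{-(b - Re α)}) as |x| → ∞. -/
open Complex MeasureTheory Filter Asymptotics Set Metric

section PowerIntegrals

variable {E : Type*} [NormedAddCommGroup E] [NormedSpace ℝ E] [FiniteDimensional ℝ E]
  [MeasurableSpace E] [BorelSpace E] (μ : Measure E) [μ.IsAddHaarMeasure]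

open scoped Pointwise in
lemma setIntegral_smul_norm_rpow (S : Set E) (s : ℝ) {R : ℝ} (hR : 0 < R) :
    ∫ z in R • S, ‖z‖ ^ s ∂μ =
      R ^ (s + Module.finrank ℝ E) * ∫ z in S, ‖z‖ ^ s ∂μ := by
  have h := Measure.setIntegral_comp_smul_of_pos μ (fun z : E => ‖z‖ ^ s) S hR
  simp only [norm_smul, Real.norm_of_nonneg hR.le, Real.mul_rpow hR.le (norm_nonneg _),
    integral_const_mul, smul_eq_mul] at h
  rw [add_comm, Real.rpow_add hR, Real.rpow_natCast, mul_assoc, h,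
    mul_inv_cancel_left₀ (by positivity)]

lemma setIntegral_ball_norm_rpow (s : ℝ) {R : ℝ} (hR : 0 < R) :
    ∫ z in ball (0 : E) R, ‖z‖ ^ s ∂μ =
      R ^ (s + Module.finrank ℝ E) * ∫ z in ball (0 : E) 1, ‖z‖ ^ s ∂μ := by
  rw [← setIntegral_smul_norm_rpow μ _ s hR, smul_unitBall hR.ne', Real.norm_of_nonneg hR.le]

open scoped Pointwise in
lemma setIntegral_compl_ball_norm_rpow (s : ℝ) {R : ℝ} (hR : 0 < R) :
    ∫ z in (ball (0 : E) R)ᶜ, ‖z‖ ^ s ∂μ =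
      R ^ (s + Module.finrank ℝ E) * ∫ z in (ball (0 : E) 1)ᶜ, ‖z‖ ^ s ∂μ := by
  have h : R • (ball (0 : E) 1)ᶜ = (R • ball (0 : E) 1)ᶜ :=
    smul_set_compl (a := Units.mk0 R hR.ne')
  rw [← setIntegral_smul_norm_rpow μ _ s hR, h, smul_unitBall hR.ne',
    Real.norm_of_nonneg hR.le]

lemma integrableOn_ball_norm_rpow (hd : 0 < Module.finrank ℝ E) {s : ℝ}
    (hs : -(Module.finrank ℝ E : ℝ) < s) (R : ℝ) :
    IntegrableOn (fun z : E => ‖z‖ ^ s) (ball 0 R) μ := by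
  refine integrableOn_ball_of_norm_le_rpow (C := 1) (α := -s) hd (by linarith) ?_
    (by fun_prop : Measurable fun z : E => ‖z‖ ^ s).aestronglyMeasurable
  refine .of_forall fun z => ?_
  rw [neg_neg, one_mul, Real.norm_of_nonneg (by positivity)]

lemma integrableOn_compl_ball_norm_rpow {s : ℝ} (hs : s < -(Module.finrank ℝ E : ℝ))
    {R : ℝ} (hR : 0 < R) :
    IntegrableOn (fun z : E => ‖z‖ ^ s) (ball 0 R)ᶜ μ := by
  have hs0 : s < 0 := hs.trans_le (by simp)
  have h := (integrable_one_add_norm (μ := μ) (E := E) (r := -s) (by linarith)).const_mul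
    ((1 / R + 1) ^ (-s))
  refine h.integrableOn.mono'
    (by fun_prop : Measurable fun z : E => ‖z‖ ^ s).aestronglyMeasurable ?_
  filter_upwards [ae_restrict_mem measurableSet_ball.compl] with z hz
  have hz : R ≤ ‖z‖ := by simpa using hz
  have hz0 : 0 < ‖z‖ := hR.trans_le hz
  have hle : 1 + ‖z‖ ≤ (1 / R + 1) * ‖z‖ := by
    have : 1 ≤ 1 / R * ‖z‖ := by rw [one_div, inv_mul_eq_div, one_le_div hR]; exact hz
    linarith
  have h2 := Real.rpow_le_rpow (by positivity) hle (neg_pos.2 hs0).le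
  rw [Real.mul_rpow (by positivity) hz0.le, Real.rpow_neg hz0.le, ← div_eq_mul_inv,
    le_div_iff₀ (by positivity)] at h2
  rw [Real.norm_of_nonneg (by positivity), Real.rpow_neg (by positivity) (-s), ← div_eq_mul_inv,
    le_div_iff₀ (by positivity), mul_comm]
  exact h2

end PowerIntegrals

lemma exists_bound_one_add_norm_rpow {E F : Type*} [NormedAddCommGroup E] [ProperSpace E]
    [NormedAddCommGroup F] {f : E → F} (hf : Continuous f) {a : ℝ} (ha : 0 < a)
    (hdecay : f =O[cocompact E] fun y => ‖y‖ ^ (-a)) :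
    ∃ C : ℝ, 0 < C ∧ ∀ y, ‖f y‖ ≤ C * (1 + ‖y‖) ^ (-a) := by
  obtain ⟨C, hC, hb⟩ := hdecay.exists_pos
  obtain ⟨K, hK, hKb⟩ := mem_cocompact.1
    (hb.bound.and (tendsto_norm_cocompact_atTop.eventually_ge_atTop (1 : ℝ)))
  have hg : Continuous fun y => ‖f y‖ * (1 + ‖y‖) ^ a :=
    hf.norm.mul ((continuous_const.add continuous_norm).rpow_const fun _ => Or.inr ha.le)
  obtain ⟨M, hM⟩ := hK.exists_bound_of_continuousOn hg.continuousOn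
  refine ⟨max M (C * 2 ^ a), lt_max_of_lt_right (by positivity), fun y => ?_⟩
  rw [Real.rpow_neg (by positivity), ← div_eq_mul_inv, le_div_iff₀ (by positivity)]
  by_cases hy : y ∈ K
  · exact (le_abs_self _).trans ((hM y hy).trans (le_max_left _ _))
  · obtain ⟨h1, h2⟩ := hKb hy
    refine le_max_of_le_right ?_
    rw [Real.norm_of_nonneg (by positivity)] at h1
    have hy0 : 0 < ‖y‖ := by linarith
    calc ‖f y‖ * (1 + ‖y‖) ^ a ≤ (C * ‖y‖ ^ (-a)) * (2 * ‖y‖) ^ a := by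
          gcongr; linarith
      _ = C * 2 ^ a := by
          rw [Real.mul_rpow (by norm_num) hy0.le, Real.rpow_neg hy0.le]
          field_simp

section Convolution

variable {E : Type*} [NormedAddCommGroup E]

lemma one_add_norm_rpow_le {a : ℝ} (ha : 0 < a) {y : E} {ρ : ℝ} (hρ : 0 < ρ) (hy : ρ ≤ ‖y‖) :
    (1 + ‖y‖) ^ (-a) ≤ ρ ^ (-a) :=
  Real.rpow_le_rpow_of_nonpos hρ (by linarith) (by linarith)

lemma half_norm_le_norm_sub {x z : E} (hz : ‖z‖ < ‖x‖ / 2) : ‖x‖ / 2 ≤ ‖x - z‖ := by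
  linarith [norm_sub_norm_le x z]

variable [NormedSpace ℝ E] [FiniteDimensional ℝ E]
  [MeasurableSpace E] [BorelSpace E] (μ : Measure E) [μ.IsAddHaarMeasure]

lemma integrable_one_add_norm_rpow_mul_norm_rpow (hd : 0 < Module.finrank ℝ E) {a c : ℝ}
    (ha : 0 < a) (hc : -(Module.finrank ℝ E : ℝ) < c) (hca : c - a < -(Module.finrank ℝ E : ℝ)) :
    Integrable (fun z : E => (1 + ‖z‖) ^ (-a) * ‖z‖ ^ c) μ := by
  have hm : Measurable fun z : E => (1 + ‖z‖) ^ (-a) * ‖z‖ ^ c := by fun_prop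
  rw [← integrableOn_univ, ← union_compl_self (ball (0 : E) 1)]
  refine IntegrableOn.union
    ((integrableOn_ball_norm_rpow μ hd hc 1).mono' hm.aestronglyMeasurable
      (.of_forall fun z => ?_))
    ((integrableOn_compl_ball_norm_rpow μ hca one_pos).mono' hm.aestronglyMeasurable ?_)
  · rw [Real.norm_of_nonneg (by positivity)]
    refine mul_le_of_le_one_left (by positivity) ?_
    exact Real.rpow_le_one_of_one_le_of_nonpos (by linarith [norm_nonneg z]) (by linarith)
  · filter_upwards [ae_restrict_mem measurableSet_ball.compl] with z hz
    have hz : 1 ≤ ‖z‖ := by simpa using hz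
    have hz0 : 0 < ‖z‖ := by linarith
    rw [Real.norm_of_nonneg (by positivity), sub_eq_neg_add, Real.rpow_add hz0]
    gcongr ?_ * _
    exact one_add_norm_rpow_le ha hz0 le_rfl

/-- Convolution of a continuous function of sufficiently fast decay with a kernel bounded by a
locally integrable power of the norm is continuous. -/
lemma continuous_integral_comp_sub_mul (hd : 0 < Module.finrank ℝ E) {f k : E → ℂ}
    (hf : Continuous f) (hk : AEStronglyMeasurable k μ) {a c C : ℝ} (ha : 0 < a) (hC : 0 < C)
    (hc : -(Module.finrank ℝ E : ℝ) < c) (hca : c - a < -(Module.finrank ℝ E : ℝ))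
    (hfb : ∀ y, ‖f y‖ ≤ C * (1 + ‖y‖) ^ (-a)) (hkb : ∀ z, ‖k z‖ ≤ ‖z‖ ^ c) :
    Continuous fun x => ∫ z, f (x - z) * k z ∂μ := by
  refine continuous_iff_continuousAt.2 fun x₀ => ?_
  refine continuousAt_of_dominated
    (bound := fun z => C * (2 + ‖x₀‖) ^ a * ((1 + ‖z‖) ^ (-a) * ‖z‖ ^ c))
    (.of_forall fun x => ?_) ?_
    ((integrable_one_add_norm_rpow_mul_norm_rpow μ hd ha hc hca).const_mul _)
    (.of_forall fun z => ?_)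
  · exact (hf.comp (continuous_const.sub continuous_id)).aestronglyMeasurable.mul hk
  · filter_upwards [ball_mem_nhds x₀ one_pos] with x hx
    refine .of_forall fun z => ?_
    rw [norm_mul, ← mul_assoc]
    refine mul_le_mul ((hfb _).trans ?_) (hkb z) (norm_nonneg _) (by positivity)
    rw [mul_assoc]
    refine mul_le_mul_of_nonneg_left ?_ hC.le
    have hx1 : ‖x‖ ≤ ‖x₀‖ + 1 := by
      have h1 : ‖x - x₀‖ < 1 := by simpa [dist_eq_norm] using hx
      linarith [norm_sub_norm_le x x₀]
    have hz : 1 + ‖z‖ ≤ (2 + ‖x₀‖) * (1 + ‖x - z‖) := by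
      have : ‖z‖ ≤ ‖x‖ + ‖x - z‖ := by
        linarith [norm_sub_norm_le z x, norm_sub_rev z x]
      nlinarith [norm_nonneg (x - z), norm_nonneg x₀,
        mul_nonneg (norm_nonneg x₀) (norm_nonneg (x - z))]
    have h2 := Real.rpow_le_rpow (by positivity) hz ha.le
    rw [Real.mul_rpow (by positivity) (by positivity)] at h2
    rw [Real.rpow_neg (by positivity), Real.rpow_neg (by positivity), ← div_eq_mul_inv,
      le_div_iff₀ (by positivity), inv_mul_le_iff₀ (by positivity), mul_comm]
    exact h2
  · fun_prop

/-- Decay of the convolution with a power of the norm for non-integrable decay rates. -/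
lemma norm_integral_comp_sub_mul_le_of_lt_finrank (hd : 0 < Module.finrank ℝ E)
    {a c C : ℝ} (ha : 0 < a) (hC : 0 < C) (hc0 : c < 0)
    (hc : -(Module.finrank ℝ E : ℝ) < c) (hca : c - a < -(Module.finrank ℝ E : ℝ))
    (had : a < Module.finrank ℝ E) :
    ∃ D : ℝ, ∀ f k : E → ℂ, (∀ y, ‖f y‖ ≤ C * (1 + ‖y‖) ^ (-a)) → (∀ z, ‖k z‖ ≤ ‖z‖ ^ c) →
      ∀ x, 0 < ‖x‖ → ‖∫ z, f (x - z) * k z ∂μ‖ ≤ D * ‖x‖ ^ (c + Module.finrank ℝ E - a) := by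
  set d : ℝ := (Module.finrank ℝ E : ℝ) with hd'
  refine ⟨C * (1 / 2) ^ (c + d - a) * (∫ z in ball (0 : E) 1, ‖z‖ ^ c ∂μ)
    + C * 2 ^ a * 2 ^ (c - a + d) * (∫ z in (ball (0 : E) 1)ᶜ, ‖z‖ ^ (c - a) ∂μ)
    + C * (1 / 2) ^ c * 3 ^ (-a + d) * (∫ z in ball (0 : E) 1, ‖z‖ ^ (-a) ∂μ),
    fun f k hfb hkb x hx => ?_⟩
  set R := ‖x‖ with hR
  have i1 := ((integrable_indicator_iff measurableSet_ball).2
    (integrableOn_ball_norm_rpow μ hd hc (R / 2))).const_mul (C * (R / 2) ^ (-a))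
  have i2 := ((integrable_indicator_iff measurableSet_ball.compl).2
    (integrableOn_compl_ball_norm_rpow μ hca (R := 2 * R) (by positivity))).const_mul (C * 2 ^ a)
  have i3 := (((integrable_indicator_iff measurableSet_ball).2
    (integrableOn_ball_norm_rpow μ hd (s := -a) (by linarith) (3 * R))).const_mul
      (C * (R / 2) ^ c)).comp_sub_left x
  have hne : ∀ᵐ z ∂μ, z ≠ x := by
    have : Nontrivial E := Module.nontrivial_of_finrank_pos hd
    exact Measure.ae_ne μ x
  have key := norm_integral_le_of_norm_le (f := fun z => f (x - z) * k z) ((i1.add i2).add i3) ?_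
  · refine key.trans (le_of_eq ?_)
    rw [integral_add' (i1.add i2) i3, integral_add' i1 i2,
      integral_sub_left_eq_self (fun y => C * (R / 2) ^ c *
        (ball (0 : E) (3 * R)).indicator (fun z => ‖z‖ ^ (-a)) y) μ x]
    simp only [integral_const_mul]
    rw [integral_indicator measurableSet_ball, integral_indicator measurableSet_ball.compl,
      integral_indicator measurableSet_ball, setIntegral_ball_norm_rpow μ c (by positivity),
      setIntegral_compl_ball_norm_rpow μ _ (by positivity),
      setIntegral_ball_norm_rpow μ (-a) (R := 3 * R) (by positivity), ← hd']
    have e1 : (R / 2) ^ (-a) * (R / 2) ^ (c + d) = (1 / 2) ^ (c + d - a) * R ^ (c + d - a) := by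
      rw [← Real.rpow_add (by positivity), ← Real.mul_rpow (by norm_num) hx.le]
      ring_nf
    have e2 : (2 * R) ^ (c - a + d) = 2 ^ (c - a + d) * R ^ (c + d - a) := by
      rw [Real.mul_rpow (by norm_num) hx.le]
      ring_nf
    have e3 : (R / 2) ^ c * (3 * R) ^ (-a + d) =
        (1 / 2) ^ c * 3 ^ (-a + d) * R ^ (c + d - a) := by
      rw [Real.mul_rpow (by norm_num) hx.le, div_eq_mul_one_div, Real.mul_rpow hx.le (by norm_num),
        show c + d - a = c + (-a + d) by ring, Real.rpow_add hx c]
      ring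
    linear_combination C * (∫ z in ball (0 : E) 1, ‖z‖ ^ c ∂μ) * e1
      + C * 2 ^ a * (∫ z in (ball (0 : E) 1)ᶜ, ‖z‖ ^ (c - a) ∂μ) * e2
      + C * (∫ z in ball (0 : E) 1, ‖z‖ ^ (-a) ∂μ) * e3
  · filter_upwards [hne] with z hz
    have n1 : 0 ≤ C * (R / 2) ^ (-a) * (ball (0 : E) (R / 2)).indicator (fun z => ‖z‖ ^ c) z :=
      mul_nonneg (by positivity) (indicator_nonneg (fun _ _ => by positivity) _)
    have n2 : 0 ≤ C * 2 ^ a * (ball (0 : E) (2 * R))ᶜ.indicator (fun z => ‖z‖ ^ (c - a)) z :=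
      mul_nonneg (by positivity) (indicator_nonneg (fun _ _ => by positivity) _)
    have n3 : 0 ≤ C * (R / 2) ^ c *
        (ball (0 : E) (3 * R)).indicator (fun z => ‖z‖ ^ (-a)) (x - z) :=
      mul_nonneg (by positivity) (indicator_nonneg (fun _ _ => by positivity) _)
    have hF : ‖f (x - z) * k z‖ ≤ C * (1 + ‖x - z‖) ^ (-a) * ‖z‖ ^ c := by
      rw [norm_mul]
      exact mul_le_mul (hfb _) (hkb z) (norm_nonneg _) (by positivity)
    refine hF.trans ?_
    simp only [Pi.add_apply]
    by_cases h1 : ‖z‖ < R / 2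
    · have : C * (1 + ‖x - z‖) ^ (-a) * ‖z‖ ^ c ≤ C * (R / 2) ^ (-a) * ‖z‖ ^ c := by
        gcongr C * ?_ * _
        exact one_add_norm_rpow_le ha (by positivity) (half_norm_le_norm_sub h1)
      rw [indicator_of_mem (by simpa using h1)] at n1 ⊢
      linarith
    · by_cases h2 : 2 * R ≤ ‖z‖
      · have hz0 : 0 < ‖z‖ := by linarith
        have : C * (1 + ‖x - z‖) ^ (-a) * ‖z‖ ^ c ≤ C * 2 ^ a * ‖z‖ ^ (c - a) := by
          calc C * (1 + ‖x - z‖) ^ (-a) * ‖z‖ ^ c ≤ C * (‖z‖ / 2) ^ (-a) * ‖z‖ ^ c := by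
                gcongr C * ?_ * _
                refine one_add_norm_rpow_le ha (by positivity) ?_
                linarith [norm_sub_norm_le z x, norm_sub_rev z x]
            _ = C * 2 ^ a * ‖z‖ ^ (c - a) := by
                rw [Real.div_rpow hz0.le (by norm_num), Real.rpow_neg zero_le_two a,
                  div_inv_eq_mul, sub_eq_add_neg, Real.rpow_add hz0]
                ring
        rw [indicator_of_mem (s := (ball (0 : E) (2 * R))ᶜ) (by simpa using h2)] at n2 ⊢
        linarith
      · have hxz : 0 < ‖x - z‖ := norm_pos_iff.2 (sub_ne_zero.2 hz.symm)
        have : C * (1 + ‖x - z‖) ^ (-a) * ‖z‖ ^ c ≤ C * (R / 2) ^ c * ‖x - z‖ ^ (-a) := by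
          rw [mul_right_comm]
          gcongr C * ?_ * ?_
          · exact Real.rpow_le_rpow_of_nonpos (by positivity) (not_lt.1 h1) hc0.le
          · exact one_add_norm_rpow_le ha hxz le_rfl
        rw [indicator_of_mem (s := ball (0 : E) (3 * R))
          (by rw [mem_ball_zero_iff]; linarith [norm_sub_le x z])] at n3 ⊢
        linarith

/-- Decay of the convolution with a power of the norm for integrable decay rates. -/
lemma norm_integral_comp_sub_mul_le_of_finrank_lt (hd : 0 < Module.finrank ℝ E)
    {a c C : ℝ} (hC : 0 < C) (hc0 : c < 0)
    (hc : -(Module.finrank ℝ E : ℝ) < c) (had : Module.finrank ℝ E < a) :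
    ∃ D : ℝ, ∀ f k : E → ℂ, (∀ y, ‖f y‖ ≤ C * (1 + ‖y‖) ^ (-a)) → (∀ z, ‖k z‖ ≤ ‖z‖ ^ c) →
      ∀ x, 1 ≤ ‖x‖ → ‖∫ z, f (x - z) * k z ∂μ‖ ≤ D * ‖x‖ ^ c := by
  set d : ℝ := (Module.finrank ℝ E : ℝ) with hd'
  have ha : 0 < a := lt_of_le_of_lt (by positivity) had
  refine ⟨C * (1 / 2) ^ (c + d - a) * (∫ z in ball (0 : E) 1, ‖z‖ ^ c ∂μ)
    + C * (1 / 2) ^ c * (∫ z : E, (1 + ‖z‖) ^ (-a) ∂μ),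
    fun f k hfb hkb x hx1 => ?_⟩
  have hx : 0 < ‖x‖ := by linarith
  set R := ‖x‖ with hR
  have i1 := ((integrable_indicator_iff measurableSet_ball).2
    (integrableOn_ball_norm_rpow μ hd hc (R / 2))).const_mul (C * (R / 2) ^ (-a))
  have i2 := ((integrable_one_add_norm (μ := μ) had).const_mul (C * (R / 2) ^ c)).comp_sub_left x
  have key := norm_integral_le_of_norm_le (f := fun z => f (x - z) * k z) (i1.add i2) ?_
  · refine key.trans ?_
    simp only [Pi.add_apply]
    rw [integral_add i1 i2,
      integral_sub_left_eq_self (fun y => C * (R / 2) ^ c * (1 + ‖y‖) ^ (-a)) μ x]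
    simp only [integral_const_mul]
    rw [integral_indicator measurableSet_ball, setIntegral_ball_norm_rpow μ c (by positivity),
      ← hd']
    have e1 : (R / 2) ^ (-a) * (R / 2) ^ (c + d) ≤ (1 / 2) ^ (c + d - a) * R ^ c := by
      calc (R / 2) ^ (-a) * (R / 2) ^ (c + d) = (1 / 2) ^ (c + d - a) * R ^ (c + d - a) := by
            rw [← Real.rpow_add (by positivity), ← Real.mul_rpow (by norm_num) hx.le]
            ring_nf
        _ ≤ _ := by
            refine mul_le_mul_of_nonneg_left ?_ (by positivity)
            exact Real.rpow_le_rpow_of_exponent_le hx1 (by linarith)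
    have e2 : (R / 2) ^ c = (1 / 2) ^ c * R ^ c := by
      rw [← Real.mul_rpow (by norm_num) hx.le]
      ring_nf
    have hK : 0 ≤ C * ∫ z in ball (0 : E) 1, ‖z‖ ^ c ∂μ :=
      mul_nonneg hC.le (integral_nonneg fun _ => by positivity)
    rw [e2]
    linarith [mul_le_mul_of_nonneg_left e1 hK]
  · refine .of_forall fun z => ?_
    have n1 : 0 ≤ C * (R / 2) ^ (-a) * (ball (0 : E) (R / 2)).indicator (fun z => ‖z‖ ^ c) z :=
      mul_nonneg (by positivity) (indicator_nonneg (fun _ _ => by positivity) _)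
    have n2 : 0 ≤ C * (R / 2) ^ c * (1 + ‖x - z‖) ^ (-a) := by positivity
    have hF : ‖f (x - z) * k z‖ ≤ C * (1 + ‖x - z‖) ^ (-a) * ‖z‖ ^ c := by
      rw [norm_mul]
      exact mul_le_mul (hfb _) (hkb z) (norm_nonneg _) (by positivity)
    refine hF.trans ?_
    simp only [Pi.add_apply]
    by_cases h1 : ‖z‖ < R / 2
    · have : C * (1 + ‖x - z‖) ^ (-a) * ‖z‖ ^ c ≤ C * (R / 2) ^ (-a) * ‖z‖ ^ c := by
        gcongr C * ?_ * _
        exact one_add_norm_rpow_le ha (by positivity) (half_norm_le_norm_sub h1)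
      rw [indicator_of_mem (by simpa using h1)] at n1 ⊢
      linarith
    · have : C * (1 + ‖x - z‖) ^ (-a) * ‖z‖ ^ c ≤ C * (R / 2) ^ c * (1 + ‖x - z‖) ^ (-a) := by
        rw [mul_right_comm]
        gcongr C * ?_ * _
        exact Real.rpow_le_rpow_of_nonpos (by positivity) (not_lt.1 h1) hc0.le
      linarith

end Convolution

theorem stmt_6 (a : ℝ) (ha : 0 < a) (n : ℕ) (hn : 0 < n)
    (f : EuclideanSpace ℝ (Fin n) → ℂ) (hfc : Continuous f)
    (hdecay : f =O[cocompact (EuclideanSpace ℝ (Fin n))] fun y => ‖y‖ ^ (-a))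
    (α : ℂ) (hα0 : 0 < α.re) (hα1 : α.re < min a n)
    (b : ℝ) (hb : α.re < b)
    (hbne : a ≠ (n : ℝ) → b ≤ min a n)
    (hbeq : a = (n : ℝ) → b < n) :
    Continuous (riesz n f α) ∧
    (riesz n f α) =O[cocompact (EuclideanSpace ℝ (Fin n))] fun x => ‖x‖ ^ (-(b - α.re)) := by
  have hn1 : 0 < Module.finrank ℝ (EuclideanSpace ℝ (Fin n)) := by simpa using hn
  have hfr : (Module.finrank ℝ (EuclideanSpace ℝ (Fin n)) : ℝ) = n := by simp
  obtain ⟨hαa, hαn⟩ := lt_min_iff.1 hα1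
  obtain ⟨C, hC, hfb⟩ := exists_bound_one_add_norm_rpow hfc ha hdecay
  set k : EuclideanSpace ℝ (Fin n) → ℂ := fun z => (‖z‖ : ℂ) ^ (α - n) with hk
  have hkm : Measurable k := by fun_prop
  have hkb : ∀ z, ‖k z‖ ≤ ‖z‖ ^ (α.re - n) := fun z => by
    rcases eq_or_ne z 0 with rfl | hz
    · have h0 : α - n ≠ 0 := fun h => by
        have := congrArg Complex.re h
        simp at this
        linarith
      simp [hk, h0, Real.zero_rpow (sub_ne_zero.2 hαn.ne)]
    · simp [hk, Complex.norm_cpow_eq_rpow_re_of_pos (norm_pos_iff.2 hz)]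
  have hriesz : riesz n f α = fun x => (Hfun n α)⁻¹ * ∫ z, f (x - z) * k z := by
    funext x
    rw [riesz, ← integral_sub_left_eq_self (fun z => f (x - z) * k z) volume x]
    simp [hk]
  rw [hriesz]
  refine ⟨continuous_const.mul (continuous_integral_comp_sub_mul volume hn1 hfc
    hkm.aestronglyMeasurable ha hC (by linarith) (by linarith) hfb hkb), ?_⟩
  refine IsBigO.const_mul_left ?_ _
  obtain ⟨D, e, he, hD⟩ : ∃ D e : ℝ, e ≤ -(b - α.re) ∧
      ∀ x, 1 ≤ ‖x‖ → ‖∫ z, f (x - z) * k z‖ ≤ D * ‖x‖ ^ e := by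
    rcases lt_or_ge (n : ℝ) a with h | h
    · obtain ⟨D, hD⟩ := norm_integral_comp_sub_mul_le_of_finrank_lt
        (volume : Measure (EuclideanSpace ℝ (Fin n))) hn1 (a := a) hC
        (c := α.re - n) (by linarith) (by linarith) (by linarith)
      have := le_min_iff.1 (hbne h.ne')
      exact ⟨D, _, by linarith, hD f k hfb hkb⟩
    · obtain ⟨a', hαa', ha'a, ha'n, hba'⟩ : ∃ a', α.re < a' ∧ a' ≤ a ∧ a' < n ∧ b ≤ a' := by
        rcases h.lt_or_eq with h | h
        · exact ⟨a, hαa, le_rfl, h, (le_min_iff.1 (hbne h.ne)).1⟩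
        · exact ⟨b, hb, by linarith [hbeq h], hbeq h, le_rfl⟩
      obtain ⟨D, hD⟩ := norm_integral_comp_sub_mul_le_of_lt_finrank
        (volume : Measure (EuclideanSpace ℝ (Fin n))) hn1 (a := a') (by linarith) hC
        (c := α.re - n) (by linarith) (by linarith) (by linarith) (by linarith)
      refine ⟨D, _, ?_, fun x hx => hD f k (fun y => (hfb y).trans ?_) hkb x (by linarith)⟩
      · linarith
      · gcongr
        linarith [norm_nonneg y]
  refine IsBigO.of_bound |D| ?_
  filter_upwards [tendsto_norm_cocompact_atTop.eventually_ge_atTop (1 : ℝ)] with x hx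
  rw [Real.norm_of_nonneg (by positivity)]
  calc _ ≤ D * ‖x‖ ^ e := hD x hx
    _ ≤ |D| * ‖x‖ ^ (-(b - α.re)) := by
      gcongr
      exact le_abs_self D
end
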